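/- arXiv:1602.05310 — 3 statements merged into one kernel-verified Lean document; each statement's English description precedes it below -/
import Mathlib

section
/- Let f : ℝ^d → ℝ be an m-strongly convex quadratic with Hessian satisfying m I ⪯ ∇²f ⪯ L I. Let Ω_b be the set of subsets of {1,...,d} of size b, let L_{max,b} := max_{I ∈ Ω_b} λ_max(P_I ∇²f P_I), and let 𝒢 ⊆ Ω_b with |𝒢^c|/|Ω_b| = α·b/d for some α ∈ [0,1]. If I_0, I_1, ... are drawn i.i.d. uniformly from Ω_b and w^{k+1} = argmin_w f(P_{I_k} w + P_{I_k^c} w^k), then after τ iterations E[f(w^τ)] − f_* ≤ (1 − (b/d)((1−α)·m/(max_{I∈𝒢} L_I) + α·m/L_{max,b}))^τ (f(w^0) − f_*). -/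
open Matrix Finset

/-- Largest eigenvalue of a real square matrix. -/
noncomputable def lamMax {ι : Type*} [Fintype ι] [DecidableEq ι]
    (A : Matrix ι ι ℝ) : ℝ :=
  sSup {μ : ℝ | Module.End.HasEigenvalue (Matrix.toLin' A) μ}

/-- Coordinate projection matrix onto the index set `I`. -/
noncomputable def proj {ι : Type*} [Fintype ι] [DecidableEq ι]
    (I : Finset ι) : Matrix ι ι ℝ :=
  Matrix.diagonal (fun i => if i ∈ I then 1 else 0)

lemma aux_lamMax {ι : Type*} [Fintype ι] [DecidableEq ι]
    (A : Matrix ι ι ℝ) (hA : A.IsHermitian) (v : ι → ℝ) :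
    v ⬝ᵥ A *ᵥ v ≤ lamMax A * (v ⬝ᵥ v) := by
  have hB : (lamMax A • (1 : Matrix ι ι ℝ) - A).IsHermitian := by
    refine Matrix.IsHermitian.sub ?_ hA
    rw [Matrix.IsHermitian, Matrix.conjTranspose_smul]
    simp
  have hfin : Set.Finite {μ : ℝ | Module.End.HasEigenvalue (Matrix.toLin' A) μ} :=
    Module.End.finite_hasEigenvalue _
  have hpos : (lamMax A • (1 : Matrix ι ι ℝ) - A).PosSemidef := by
    rw [hB.posSemidef_iff_eigenvalues_nonneg]
    intro j
    have h1 := hB.mulVec_eigenvectorBasis j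
    set u : ι → ℝ := (hB.eigenvectorBasis j).ofLp with hu
    have hu0 : u ≠ 0 := by
      intro h
      have := hB.eigenvectorBasis.toBasis.ne_zero j
      apply this
      ext i
      have := congrFun h i
      simpa [hu] using this
    have h2 : A *ᵥ u = (lamMax A - hB.eigenvalues j) • u := by
      rw [Matrix.sub_mulVec, Matrix.smul_mulVec, Matrix.one_mulVec] at h1
      rw [sub_smul, ← h1]; abel
    have h3 : Module.End.HasEigenvalue (Matrix.toLin' A) (lamMax A - hB.eigenvalues j) := by
      apply Module.End.hasEigenvalue_of_hasEigenvector (x := u)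
      refine ⟨?_, hu0⟩
      rw [Module.End.mem_eigenspace_iff, Matrix.toLin'_apply, h2]
    have h4 : lamMax A - hB.eigenvalues j ≤ lamMax A := le_csSup hfin.bddAbove h3
    simpa using h4
  have := hpos.dotProduct_mulVec_nonneg v
  rw [Matrix.sub_mulVec, Matrix.smul_mulVec, Matrix.one_mulVec, dotProduct_sub,
    dotProduct_smul] at this
  simp at this
  linarith

lemma aux_count {d b : ℕ} (hb : 1 ≤ b) (hbd : b ≤ d) (i : Fin d) :
    ((((Finset.powersetCard b (Finset.univ : Finset (Fin d))).filter (fun I => i ∈ I)).card : ℕ) : ℝ)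
      = (b / d : ℝ) * (Finset.powersetCard b (Finset.univ : Finset (Fin d))).card := by
  obtain ⟨b, rfl⟩ : ∃ k, b = k + 1 := ⟨b - 1, by omega⟩
  obtain ⟨d, rfl⟩ : ∃ k, d = k + 1 := ⟨d - 1, by omega⟩
  have h : (Finset.powersetCard (b+1) (Finset.univ : Finset (Fin (d+1)))).filter (fun I => i ∈ I)
      = (Finset.powersetCard b (Finset.univ.erase i)).image (insert i) := by
    ext I
    simp only [Finset.mem_filter, Finset.mem_powersetCard, Finset.mem_image]
    constructor
    · rintro ⟨⟨_, h1⟩, h2⟩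
      refine ⟨I.erase i, ⟨Finset.erase_subset_erase _ (Finset.subset_univ _), ?_⟩, Finset.insert_erase h2⟩
      rw [Finset.card_erase_of_mem h2, h1]; rfl
    · rintro ⟨J, ⟨h1, h2⟩, rfl⟩
      have : i ∉ J := fun h => by simpa using h1 h
      refine ⟨⟨Finset.subset_univ _, ?_⟩, Finset.mem_insert_self _ _⟩
      rw [Finset.card_insert_of_notMem this, h2]
  have hinj : Set.InjOn (insert i) (Finset.powersetCard b (Finset.univ.erase i) : Set (Finset (Fin (d+1)))) := by
    intro J hJ K hK hJK
    simp only [Finset.mem_coe, Finset.mem_powersetCard] at hJ hK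
    have h1 : i ∉ J := fun h => by simpa using hJ.1 h
    have h2 : i ∉ K := fun h => by simpa using hK.1 h
    rw [← Finset.erase_insert h1, ← Finset.erase_insert h2, hJK]
  rw [h, Finset.card_image_of_injOn hinj, Finset.card_powersetCard, Finset.card_powersetCard,
    Finset.card_erase_of_mem (Finset.mem_univ _)]
  simp only [Finset.card_univ, Fintype.card_fin, Nat.add_sub_cancel]
  have := Nat.add_one_mul_choose_eq d b
  have h' : ((d:ℝ)+1) * (d.choose b) = ((d+1).choose (b+1)) * ((b:ℝ)+1) := by exact_mod_cast this
  push_cast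
  have : (d:ℝ)+1 ≠ 0 := by positivity
  field_simp
  linarith

lemma aux_expand {d : ℕ} (H : Matrix (Fin d) (Fin d) ℝ) (hH : H.IsHermitian)
    (c : Fin d → ℝ) (r : ℝ) (f : (Fin d → ℝ) → ℝ)
    (hf : ∀ w, f w = (1 / 2) * (w ⬝ᵥ H.mulVec w) + c ⬝ᵥ w + r) (w u : Fin d → ℝ) :
    f (w + u) = f w + (H *ᵥ w + c) ⬝ᵥ u + (1/2) * (u ⬝ᵥ H *ᵥ u) := by
  have hs : w ⬝ᵥ H *ᵥ u = (H *ᵥ w) ⬝ᵥ u := by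
    rw [dotProduct_mulVec, ← Matrix.mulVec_transpose]
    have : Hᵀ = H := by simpa [Matrix.IsHermitian] using hH
    rw [this]
  rw [hf, hf, Matrix.mulVec_add]
  simp only [dotProduct_add, add_dotProduct]
  rw [hs, dotProduct_comm u (H *ᵥ w)]
  ring

lemma aux_sum_pi {β : Type*} [DecidableEq β] (n : ℕ) (S : Finset β) (F : (Fin (n+1) → β) → ℝ) :
    ∑ s ∈ Fintype.piFinset (fun _ : Fin (n+1) => S), F s =
      ∑ I ∈ S, ∑ s ∈ Fintype.piFinset (fun _ : Fin n => S), F (Fin.cons I s) := by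
  rw [← Finset.sum_product']
  symm
  refine Finset.sum_nbij' (fun p => Fin.cons p.1 p.2) (fun s => (s 0, fun i => s i.succ)) ?_ ?_ ?_ ?_ ?_
  · rintro ⟨I, s⟩ h
    simp only [Finset.mem_product, Fintype.mem_piFinset] at h ⊢
    intro i
    refine Fin.cases ?_ ?_ i
    · simpa using h.1
    · intro j; simpa using h.2 j
  · intro s h
    simp only [Finset.mem_product, Fintype.mem_piFinset] at h ⊢
    exact ⟨h 0, fun i => h _⟩
  · rintro ⟨I, s⟩ h; simp
  · intro s h; exact Fin.cons_self_tail s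
  · intros; rfl

/-- Iterating a one-step contraction in expectation. -/
lemma aux_iter {β E : Type*} [DecidableEq β] (S : Finset β) (φ : E → ℝ) (step : β → E → E) (ρ : ℝ)
    (hρ : 0 ≤ ρ) (h1 : ∀ w, ∑ I ∈ S, φ (step I w) ≤ S.card * (ρ * φ w)) :
    ∀ (τ : ℕ) (w0 : E) (W : (Fin τ → β) → ℕ → E) (_ : ∀ s, W s 0 = w0)
    (_ : ∀ s k (h : k < τ), W s (k + 1) = step (s ⟨k, h⟩) (W s k)),
    ∑ s ∈ Fintype.piFinset (fun _ : Fin τ => S), φ (W s τ) ≤ (S.card : ℝ) ^ τ * (ρ ^ τ * φ w0) := by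
  intro τ
  induction τ with
  | zero =>
    intro w0 W hW0 _
    simp [hW0]
  | succ n ih =>
    intro w0 W hW0 hWs
    rw [aux_sum_pi]
    calc _ ≤ ∑ I ∈ S, (S.card : ℝ) ^ n * (ρ ^ n * φ (step I w0)) := by
          refine Finset.sum_le_sum fun I _ => ?_
          refine ih (step I w0) (fun s k => W (Fin.cons I s) (k+1)) ?_ ?_
          · intro s
            have := hWs (Fin.cons I s) 0 (Nat.succ_pos n)
            rw [hW0] at this
            exact this
          · intro s k h
            exact hWs (Fin.cons I s) (k+1) (Nat.succ_lt_succ h)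
      _ = ((S.card : ℝ) ^ n * ρ ^ n) * ∑ I ∈ S, φ (step I w0) := by
          rw [Finset.mul_sum]; refine Finset.sum_congr rfl fun _ _ => by ring
      _ ≤ ((S.card : ℝ) ^ n * ρ ^ n) * (S.card * (ρ * φ w0)) := by
          gcongr; exact h1 w0
      _ = _ := by ring

lemma aux_quad {d : ℕ} (H : Matrix (Fin d) (Fin d) ℝ) (hH : H.IsHermitian) (I : Finset (Fin d))
    (u : Fin d → ℝ) (hu : ∀ i, i ∉ I → u i = 0) :
    u ⬝ᵥ H *ᵥ u ≤ lamMax (proj I * H * proj I) * (u ⬝ᵥ u) := by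
  have hp : proj I *ᵥ u = u := by
    ext i
    rw [proj, Matrix.mulVec_diagonal]
    by_cases h : i ∈ I
    · simp [h]
    · simp [h, hu i h]
  have hpt : (proj I)ᵀ = proj I := by simp [proj]
  have hpH : (proj I)ᴴ = proj I := by rw [Matrix.conjTranspose_eq_transpose_of_trivial, hpt]
  have hA : (proj I * H * proj I).IsHermitian := by
    have := Matrix.isHermitian_mul_mul_conjTranspose (proj I) hH
    rwa [hpH] at this
  have := aux_lamMax _ hA u
  rw [← Matrix.mulVec_mulVec, hp, ← Matrix.mulVec_mulVec, dotProduct_mulVec,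
    ← Matrix.mulVec_transpose, hpt, hp] at this
  exact this

lemma aux_dec {d : ℕ} (H : Matrix (Fin d) (Fin d) ℝ) (hH : H.IsHermitian)
    (c : Fin d → ℝ) (r : ℝ) (f : (Fin d → ℝ) → ℝ)
    (hf : ∀ w, f w = (1 / 2) * (w ⬝ᵥ H.mulVec w) + c ⬝ᵥ w + r)
    (step : Finset (Fin d) → (Fin d → ℝ) → (Fin d → ℝ))
    (hstep_min : ∀ I w (v : Fin d → ℝ),
      f (step I w) ≤ f (fun i => if i ∈ I then v i else w i))
    (I : Finset (Fin d)) (w : Fin d → ℝ) (K : ℝ) (hK : 0 < K)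
    (hle : lamMax (proj I * H * proj I) ≤ K) :
    f (step I w) ≤ f w - (1 / (2 * K)) * ∑ i ∈ I, ((H *ᵥ w + c) i) ^ 2 := by
  set g := H *ᵥ w + c with hg
  set u : Fin d → ℝ := fun i => if i ∈ I then -(1 / K) * g i else 0 with hu
  have h1 := hstep_min I w (w + u)
  have h2 : (fun i => if i ∈ I then (w + u) i else w i) = w + u := by
    ext i
    by_cases h : i ∈ I <;> simp [h, hu]
  rw [h2, aux_expand H hH c r f hf w u, ← hg] at h1
  have h3 := aux_quad H hH I u (fun i hi => by simp [hu, hi])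
  have h4 : u ⬝ᵥ u = (1 / K) ^ 2 * ∑ i ∈ I, (g i) ^ 2 := by
    simp only [dotProduct, hu, Finset.mul_sum]
    rw [← Finset.sum_filter_add_sum_filter_not Finset.univ (fun i => i ∈ I)]
    rw [Finset.sum_eq_zero (s := Finset.univ.filter (fun i => i ∉ I)), add_zero]
    · rw [Finset.filter_univ_mem]
      refine Finset.sum_congr rfl fun i hi => ?_
      rw [if_pos hi]; ring
    · intro i hi
      have : i ∉ I := by simpa using hi
      simp [this]
  have h5 : g ⬝ᵥ u = -(1 / K) * ∑ i ∈ I, (g i) ^ 2 := by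
    simp only [dotProduct, hu, Finset.mul_sum]
    rw [← Finset.sum_filter_add_sum_filter_not Finset.univ (fun i => i ∈ I)]
    rw [Finset.sum_eq_zero (s := Finset.univ.filter (fun i => i ∉ I)), add_zero]
    · rw [Finset.filter_univ_mem]
      refine Finset.sum_congr rfl fun i hi => ?_
      rw [if_pos hi]; ring
    · intro i hi
      have : i ∉ I := by simpa using hi
      simp [this]
  have hS : 0 ≤ u ⬝ᵥ u := by
    rw [h4]; positivity
  have h6 := h3.trans (mul_le_mul_of_nonneg_right hle hS)
  rw [h4] at h6
  rw [h5] at h1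
  have e1 : K * ((1 / K) ^ 2 * ∑ i ∈ I, (g i) ^ 2) = (1 / K) * ∑ i ∈ I, (g i) ^ 2 := by
    field_simp
  have e2 : (1 / (2 * K)) * ∑ i ∈ I, (g i) ^ 2 = (1/2) * ((1 / K) * ∑ i ∈ I, (g i) ^ 2) := by
    field_simp
  rw [e1] at h6
  rw [e2]
  linarith

lemma aux_low {d : ℕ} (H : Matrix (Fin d) (Fin d) ℝ) (m : ℝ)
    (hlow : ((H - m • (1 : Matrix (Fin d) (Fin d) ℝ))).PosSemidef) (u : Fin d → ℝ) :
    m * (u ⬝ᵥ u) ≤ u ⬝ᵥ H *ᵥ u := by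
  have := hlow.dotProduct_mulVec_nonneg u
  rw [Matrix.sub_mulVec, Matrix.smul_mulVec, Matrix.one_mulVec, dotProduct_sub,
    dotProduct_smul] at this
  simp at this
  linarith

lemma aux_pl {d : ℕ} (H : Matrix (Fin d) (Fin d) ℝ) (hH : H.IsHermitian) (m : ℝ) (hm : 0 < m)
    (hlow : ((H - m • (1 : Matrix (Fin d) (Fin d) ℝ))).PosSemidef)
    (c : Fin d → ℝ) (r : ℝ) (f : (Fin d → ℝ) → ℝ)
    (hf : ∀ w, f w = (1 / 2) * (w ⬝ᵥ H.mulVec w) + c ⬝ᵥ w + r)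
    (fstar : ℝ) (hstar : IsGLB (Set.range f) fstar) (w : Fin d → ℝ) :
    2 * m * (f w - fstar) ≤ ∑ i, ((H *ᵥ w + c) i) ^ 2 := by
  set g := H *ᵥ w + c with hg
  have : f w - (1 / (2 * m)) * ∑ i, (g i) ^ 2 ≤ fstar := by
    refine hstar.2 ?_
    rintro _ ⟨y, rfl⟩
    have h1 := aux_expand H hH c r f hf w (y - w)
    rw [add_sub_cancel, ← hg] at h1
    have h2 := aux_low H m hlow (y - w)
    have h3 : 0 ≤ g ⬝ᵥ (y - w) + (1/2) * (m * ((y - w) ⬝ᵥ (y - w)))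
        + (1 / (2 * m)) * ∑ i, (g i) ^ 2 := by
      simp only [dotProduct, Finset.mul_sum]
      rw [← Finset.sum_add_distrib, ← Finset.sum_add_distrib]
      refine Finset.sum_nonneg fun i _ => ?_
      have : g i * (y - w) i + 1 / 2 * (m * ((y - w) i * (y - w) i)) + 1 / (2 * m) * g i ^ 2
          = (1 / (2 * m)) * (g i + m * (y - w) i) ^ 2 := by
        field_simp; ring
      rw [this]; positivity
    linarith
  have e : 2 * m * ((1 / (2 * m)) * ∑ i, (g i) ^ 2) = ∑ i, (g i) ^ 2 := by field_simp
  nlinarith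

/-- Convergence rate of randomized block coordinate descent on an `m`-strongly
convex quadratic, given a large set `𝒢` of blocks on which the restricted
Lipschitz constant is controlled (Lemma `rateset`).  The expectation over the
i.i.d. uniform choice of blocks is written as an average over all block
sequences. -/
theorem bcd_rate_good_set {d b : ℕ} (hb : 1 ≤ b) (hbd : b ≤ d)
    (H : Matrix (Fin d) (Fin d) ℝ) (m L : ℝ) (hm : 0 < m)
    (hlow : ((H - m • (1 : Matrix (Fin d) (Fin d) ℝ))).PosSemidef)
    (hup : ((L • (1 : Matrix (Fin d) (Fin d) ℝ) - H)).PosSemidef)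
    (c : Fin d → ℝ) (r : ℝ) (f : (Fin d → ℝ) → ℝ)
    (hf : ∀ w, f w = (1 / 2) * (w ⬝ᵥ H.mulVec w) + c ⬝ᵥ w + r)
    -- the family of all size-b blocks and the good set 𝒢
    (Ωb : Finset (Finset (Fin d))) (hΩb : Ωb = Finset.powersetCard b Finset.univ)
    (𝒢 : Finset (Finset (Fin d))) (h𝒢 : 𝒢 ⊆ Ωb)
    (α : ℝ) (hα0 : 0 ≤ α) (hα1 : α ≤ 1)
    (hfrac : ((Ωb \ 𝒢).card : ℝ) = α * (b / d) * Ωb.card)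
    -- restricted Lipschitz constants
    (LG : ℝ) (hLG : IsGreatest ((fun I => lamMax (proj I * H * proj I)) '' (𝒢 : Set (Finset (Fin d)))) LG)
    (Lmaxb : ℝ)
    (hLmaxb : IsGreatest ((fun I => lamMax (proj I * H * proj I)) '' (Ωb : Set (Finset (Fin d)))) Lmaxb)
    -- exact block minimization step
    (step : Finset (Fin d) → (Fin d → ℝ) → (Fin d → ℝ))
    (hstep_fix : ∀ I w i, i ∉ I → step I w i = w i)
    (hstep_min : ∀ I w (v : Fin d → ℝ),
      f (step I w) ≤ f (fun i => if i ∈ I then v i else w i))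
    -- iterates along a sequence of blocks
    (τ : ℕ) (w0 : Fin d → ℝ)
    (W : (Fin τ → Finset (Fin d)) → ℕ → (Fin d → ℝ))
    (hW0 : ∀ s, W s 0 = w0)
    (hWsucc : ∀ s k (h : k < τ), W s (k + 1) = step (s ⟨k, h⟩) (W s k))
    (fstar : ℝ) (hstar : IsGLB (Set.range f) fstar) :
    (1 / (Ωb.card : ℝ) ^ τ) *
        ∑ s ∈ Fintype.piFinset (fun _ : Fin τ => Ωb), (f (W s τ) - fstar) ≤
      (1 - (b / d) * ((1 - α) * m / LG + α * m / Lmaxb)) ^ τ * (f w0 - fstar) := by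
  have hH : H.IsHermitian := by
    have h := hlow.1
    have h' : (m • (1 : Matrix (Fin d) (Fin d) ℝ)).IsHermitian := by
      rw [Matrix.IsHermitian, Matrix.conjTranspose_smul]; simp
    have := h.add h'
    simpa using this
  have hlam : ∀ I ∈ Ωb, m ≤ lamMax (proj I * H * proj I) := by
    intro I hI
    rw [hΩb, Finset.mem_powersetCard] at hI
    obtain ⟨i, hi⟩ : I.Nonempty := by
      rw [← Finset.card_pos]; omega
    have h1 := aux_quad H hH I (Pi.single i 1) (fun j hj => by
      rw [Pi.single_eq_of_ne]; rintro rfl; exact hj hi)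
    have h2 := aux_low H m hlow (Pi.single i 1)
    have h3 := h2.trans h1
    simpa using h3
  obtain ⟨⟨I1, hI1, hI1e⟩, hLGub⟩ := hLG
  obtain ⟨⟨I2, hI2, hI2e⟩, hLmub⟩ := hLmaxb
  have hmLG : m ≤ LG := by rw [← hI1e]; exact hlam I1 (h𝒢 hI1)
  have hLGm : LG ≤ Lmaxb := hLmub ⟨I1, h𝒢 hI1, hI1e⟩
  have hLG0 : 0 < LG := hm.trans_le hmLG
  have hLm0 : 0 < Lmaxb := hLG0.trans_le hLGm
  have hd0 : (0:ℝ) < d := by exact_mod_cast (by omega : 0 < d)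
  have hb0 : (0:ℝ) < b := by exact_mod_cast (by omega : 0 < b)
  have hbd1 : (b / d : ℝ) ≤ 1 := by
    rw [div_le_one hd0]; exact_mod_cast hbd
  have hbd0 : (0:ℝ) ≤ b / d := by positivity
  have hN0 : (0:ℝ) < Ωb.card := by
    exact_mod_cast Finset.card_pos.mpr ⟨I2, hI2⟩
  set ρ : ℝ := 1 - (b / d) * ((1 - α) * m / LG + α * m / Lmaxb) with hρdef
  have hρ : 0 ≤ ρ := by
    have h1 : m / LG ≤ 1 := by rw [div_le_one hLG0]; exact hmLG
    have h2 : m / Lmaxb ≤ 1 := by rw [div_le_one hLm0]; linarith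
    have h3 : (1 - α) * m / LG + α * m / Lmaxb ≤ 1 := by
      rw [mul_div_assoc, mul_div_assoc]
      nlinarith
    have h4 : 0 ≤ (1 - α) * m / LG + α * m / Lmaxb := by
      have : 0 ≤ 1 - α := by linarith
      positivity
    have := mul_le_one₀ hbd1 h4 h3
    linarith
  have hone : ∀ w, ∑ I ∈ Ωb, (f (step I w) - fstar) ≤ Ωb.card * (ρ * (f w - fstar)) := by
    intro w
    set g := H *ᵥ w + c with hg
    set G : ℝ := ∑ i, (g i) ^ 2 with hG
    have hG0 : 0 ≤ G := by positivity
    have hpl := aux_pl H hH m hm hlow c r f hf fstar hstar w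
    rw [← hg, ← hG] at hpl
    let q : Finset (Fin d) → ℝ := fun I => ∑ i ∈ I, (g i) ^ 2
    have hqG : ∀ I, q I ≤ G := fun I =>
      Finset.sum_le_sum_of_subset_of_nonneg (Finset.subset_univ I) (fun _ _ _ => sq_nonneg _)
    have htot : ∑ I ∈ Ωb, q I = (b / d) * Ωb.card * G := by
      have : ∀ I : Finset (Fin d), q I = ∑ i, if i ∈ I then (g i) ^ 2 else 0 := by
        intro I
        rw [← Finset.sum_filter, Finset.filter_univ_mem]
      simp_rw [this]
      rw [Finset.sum_comm, hG, Finset.mul_sum]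
      refine Finset.sum_congr rfl fun i _ => ?_
      rw [← Finset.sum_filter, Finset.sum_const, nsmul_eq_mul, hΩb, aux_count hb hbd i]
    have hbad : ∑ I ∈ Ωb \ 𝒢, q I ≤ α * (b / d) * Ωb.card * G := by
      calc _ ≤ ∑ I ∈ Ωb \ 𝒢, G := Finset.sum_le_sum fun I _ => hqG I
        _ = _ := by rw [Finset.sum_const, nsmul_eq_mul, hfrac]
    have hsplit : ∑ I ∈ Ωb \ 𝒢, q I + ∑ I ∈ 𝒢, q I = ∑ I ∈ Ωb, q I := Finset.sum_sdiff h𝒢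
    have hA : ∑ I ∈ 𝒢, (f (step I w) - f w) ≤ -(1 / (2 * LG)) * ∑ I ∈ 𝒢, q I := by
      rw [Finset.mul_sum]
      refine Finset.sum_le_sum fun I hI => ?_
      have := aux_dec H hH c r f hf step hstep_min I w LG hLG0 (hLGub ⟨I, hI, rfl⟩)
      simp only [q]; linarith
    have hB : ∑ I ∈ Ωb \ 𝒢, (f (step I w) - f w) ≤ -(1 / (2 * Lmaxb)) * ∑ I ∈ Ωb \ 𝒢, q I := by
      rw [Finset.mul_sum]
      refine Finset.sum_le_sum fun I hI => ?_
      have := aux_dec H hH c r f hf step hstep_min I w Lmaxb hLm0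
        (hLmub ⟨I, (Finset.mem_sdiff.mp hI).1, rfl⟩)
      simp only [q]; linarith
    have hAB : ∑ I ∈ Ωb \ 𝒢, (f (step I w) - f w) + ∑ I ∈ 𝒢, (f (step I w) - f w)
      = ∑ I ∈ Ωb, (f (step I w) - f w) := Finset.sum_sdiff h𝒢
    have hdiff : ∑ I ∈ Ωb, (f (step I w) - fstar)
        = ∑ I ∈ Ωb, (f (step I w) - f w) + Ωb.card * (f w - fstar) := by
      rw [← nsmul_eq_mul, ← Finset.sum_const, ← Finset.sum_add_distrib]
      refine Finset.sum_congr rfl fun _ _ => by ring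
    set a := 1 / (2 * LG) with ha
    set e := 1 / (2 * Lmaxb) with he
    have hea : e ≤ a := by
      rw [ha, he]; exact one_div_le_one_div_of_le (by positivity) (by linarith)
    have he0 : 0 < e := by positivity
    have hρe : ρ = 1 - (b / d) * (((1 - α) * a + α * e) * (2 * m)) := by
      rw [hρdef, ha, he]; field_simp
    have hgq : ∑ I ∈ 𝒢, q I = (b / d) * Ωb.card * G - ∑ I ∈ Ωb \ 𝒢, q I := by linarith
    rw [hgq] at hA
    have h7 : (a - e) * ∑ I ∈ Ωb \ 𝒢, q I ≤ (a - e) * (α * (b / d) * Ωb.card * G) :=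
      mul_le_mul_of_nonneg_left hbad (by linarith)
    have hk : 0 ≤ (b / d) * Ωb.card * ((1 - α) * a + α * e) := by
      have : 0 ≤ 1 - α := by linarith
      have : 0 ≤ a := by linarith
      positivity
    have h8 := mul_le_mul_of_nonneg_left hpl hk
    rw [hdiff, ← hAB, hρe]
    linarith
  have := aux_iter Ωb (fun w => f w - fstar) step ρ hρ hone τ w0 W hW0 hWsucc
  rw [one_div, inv_mul_le_iff₀ (by positivity)]
  exact this
end

section
/- Fix Ψ ∈ ℝ^{n×m} with columns ψ_i, let B := max_i ‖ψ_i‖², choose p indices I = (i_1,...,i_p) uniformly at random without replacement from {1,...,m}, and let S ∈ ℝ^{n×p} be the corresponding column selector matrix. Then with probability at least 1 − δ, λ_max(Ψ S Sᵀ Ψᵀ) ≥ (p/m) λ_max(ΨΨᵀ) − (4/3)·(λ_max(ΨΨᵀ)/m)·log(n/δ) − √((8p/m) λ_max(ΨΨᵀ) B log(n/δ)). -/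
open Matrix Finset

/-- elementary symmetric sum -/
noncomputable def eSum {ι : Type*} (a : ι → ℝ) (k : ℕ) (s : Finset ι) : ℝ :=
  ∑ t ∈ powersetCard k s, ∏ i ∈ t, a i

section
variable {ι : Type*} [DecidableEq ι] (a : ι → ℝ)

lemma eSum_zero (s : Finset ι) : eSum a 0 s = 1 := by simp [eSum]

lemma eSum_nonneg (ha : ∀ i, 0 ≤ a i) (k : ℕ) (s : Finset ι) : 0 ≤ eSum a k s :=
  sum_nonneg fun _ _ => prod_nonneg fun i _ => ha i

lemma eSum_insert {s : Finset ι} {i : ι} (hi : i ∉ s) (k : ℕ) :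
    eSum a (k+1) (insert i s) = eSum a (k+1) s + a i * eSum a k s := by
  unfold eSum
  rw [powersetCard_succ_insert hi, sum_union, sum_image, mul_sum]
  · congr 1
    refine sum_congr rfl fun t ht => ?_
    rw [prod_insert]
    exact fun h => hi ((mem_powersetCard.1 ht).1 h)
  · intro t ht u hu h
    have h1 : i ∉ t := fun h => hi ((mem_powersetCard.1 ht).1 h)
    have h2 : i ∉ u := fun h => hi ((mem_powersetCard.1 hu).1 h)
    rw [← erase_insert h1, ← erase_insert h2]
    exact congrArg (fun x => erase x i) h
  · rw [disjoint_left]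
    intro t ht hu
    obtain ⟨u, -, rfl⟩ := mem_image.1 hu
    exact hi ((mem_powersetCard.1 ht).1 (mem_insert_self _ _))

lemma eSum_erase {s : Finset ι} {i : ι} (hi : i ∈ s) (k : ℕ) :
    eSum a (k+1) s = eSum a (k+1) (s.erase i) + a i * eSum a k (s.erase i) := by
  rw [← eSum_insert a (notMem_erase i s), insert_erase hi]

lemma sum_eSum_erase (s : Finset ι) (k : ℕ) :
    ∑ i ∈ s, eSum a k (s.erase i) = ((#s : ℝ) - k) * eSum a k s := by
  unfold eSum
  rw [sum_comm' (t' := powersetCard k s) (s' := fun t => s \ t)]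
  · rw [mul_sum]
    refine sum_congr rfl fun t ht => ?_
    obtain ⟨h1, h2⟩ := mem_powersetCard.1 ht
    rw [sum_const, nsmul_eq_mul, card_sdiff_of_subset h1, Nat.cast_sub (card_le_card h1), h2]
  · intro i t
    simp only [mem_powersetCard, mem_sdiff, subset_erase]
    tauto

lemma sum_mul_eSum_erase (s : Finset ι) (k : ℕ) :
    ∑ i ∈ s, a i * eSum a k (s.erase i) = (k+1) * eSum a (k+1) s := by
  have h : ∑ i ∈ s, eSum a (k+1) s
      = ∑ i ∈ s, (eSum a (k+1) (s.erase i) + a i * eSum a k (s.erase i)) :=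
    sum_congr rfl fun i hi => eSum_erase a hi k
  rw [sum_add_distrib, sum_eSum_erase, sum_const, nsmul_eq_mul] at h
  push_cast at h
  linarith

lemma eSum_anti (ha : ∀ i, 0 ≤ a i) (s : Finset ι) (k : ℕ) {i j : ι} (hi : i ∈ s) (hj : j ∈ s)
    (hij : a i ≤ a j) : eSum a k (s.erase j) ≤ eSum a k (s.erase i) := by
  rcases eq_or_ne i j with rfl | hne
  · exact le_rfl
  cases k with
  | zero => simp [eSum_zero]
  | succ k =>
    rw [eSum_erase a (mem_erase.2 ⟨hne, hi⟩), eSum_erase a (mem_erase.2 ⟨hne.symm, hj⟩),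
      erase_right_comm]
    have := eSum_nonneg a ha k ((s.erase i).erase j)
    have := mul_le_mul_of_nonneg_right hij this
    linarith

lemma eSum_step (ha : ∀ i, 0 ≤ a i) (s : Finset ι) (k : ℕ) :
    (#s : ℝ) * ((k+1) * eSum a (k+1) s) ≤ (∑ i ∈ s, a i) * (((#s : ℝ) - k) * eSum a k s) := by
  have h : AntivaryOn a (fun i => eSum a k (s.erase i)) s := by
    intro i hi j hj h
    by_contra hc
    exact absurd (eSum_anti a ha s k hi hj (not_le.1 hc).le) (not_le.2 h)
  have := h.card_mul_sum_le_sum_mul_sum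
  rwa [sum_mul_eSum_erase, sum_eSum_erase] at this

lemma maclaurin (ha : ∀ i, 0 ≤ a i) (s : Finset ι) (hs : s.Nonempty) (k : ℕ) (hk : k ≤ #s) :
    eSum a k s ≤ (Nat.choose #s k : ℝ) * ((∑ i ∈ s, a i) / #s) ^ k := by
  have hm : (0:ℝ) < #s := by exact_mod_cast hs.card_pos
  induction k with
  | zero => simp [eSum_zero]
  | succ k ih =>
    have h1 := ih (by omega)
    have h2 := eSum_step a ha s k
    have hS : 0 ≤ ∑ i ∈ s, a i := sum_nonneg fun i _ => ha i
    have hc : (Nat.choose #s (k+1) : ℝ) * (k+1) = Nat.choose #s k * ((#s : ℝ) - k) := by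
      have := Nat.choose_succ_right_eq #s k
      rw [← Nat.cast_sub (by omega)]
      exact_mod_cast this
    have hk' : (0:ℝ) ≤ (#s : ℝ) - k := by
      rw [← Nat.cast_sub (by omega)]; positivity
    have hk1 : (0:ℝ) < (k:ℝ)+1 := by positivity
    refine le_of_mul_le_mul_left ?_ (mul_pos hm hk1)
    calc (#s : ℝ) * (k+1) * eSum a (k+1) s
        ≤ (∑ i ∈ s, a i) * (((#s : ℝ) - k) * eSum a k s) := by linarith
      _ ≤ (∑ i ∈ s, a i) * (((#s : ℝ) - k) *
            ((Nat.choose #s k : ℝ) * ((∑ i ∈ s, a i) / #s) ^ k)) := by gcongr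
      _ = (∑ i ∈ s, a i) * ((Nat.choose #s k * ((#s : ℝ) - k)) * ((∑ i ∈ s, a i) / #s) ^ k) := by
          ring
      _ = _ := by
          rw [← hc, pow_succ]; field_simp
end

lemma exp_neg_le_quad {y : ℝ} (hy : 0 ≤ y) : Real.exp (-y) ≤ 1 - y + y^2/2 := by
  have h := Real.quadratic_le_exp_of_nonneg hy
  have h1 : Real.exp (-y) * Real.exp y = 1 := by rw [← Real.exp_add]; simp
  have h2 : 0 < 1 - y + y^2/2 := by nlinarith [sq_nonneg (y-1)]
  have h3 : 1 ≤ (1 - y + y^2/2) * (1 + y + y^2/2) := by nlinarith [sq_nonneg (y^2)]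
  have h4 : 1 ≤ (1 - y + y^2/2) * Real.exp y := h3.trans (by gcongr)
  refine le_of_mul_le_mul_right ?_ (Real.exp_pos y)
  rw [h1]; exact h4

/-- lower tail count bound -/
lemma tail_count {m p : ℕ} (hp : 1 ≤ p) (hpm : p ≤ m) (x : Fin m → ℝ) (B : ℝ)
    (hx : ∀ i, 0 ≤ x i) (hxB : ∀ i, x i ≤ B) (s T : ℝ) (hs : 0 ≤ s) :
    (#{I ∈ powersetCard p (univ : Finset (Fin m)) | ∑ i ∈ I, x i < T} : ℝ) ≤
      (#(powersetCard p (univ : Finset (Fin m))) : ℝ) *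
        Real.exp (s * T - s * (p / m * ∑ i, x i) + s^2 / 2 * (p / m * (∑ i, x i) * B)) := by
  have hm : (0:ℝ) < m := by exact_mod_cast (by omega : 0 < m)
  have hne : (univ : Finset (Fin m)).Nonempty := ⟨⟨0, by omega⟩, mem_univ _⟩
  have hmac := maclaurin (fun i => Real.exp (-(s * x i))) (fun i => (Real.exp_pos _).le)
    univ hne p (by simpa using hpm)
  have hcard : #(univ : Finset (Fin m)) = m := by simp
  have havg : (∑ i, Real.exp (-(s * x i))) / (#(univ : Finset (Fin m)) : ℝ) ≤
      Real.exp (-(s * (∑ i, x i) / m) + s^2/2 * ((∑ i, x i) * B / m)) := by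
    rw [hcard]
    refine le_trans ?_ (Real.add_one_le_exp _)
    rw [div_le_iff₀ hm]
    calc ∑ i, Real.exp (-(s * x i)) ≤ ∑ i, (1 - s * x i + s^2/2 * (x i * B)) := by
          refine sum_le_sum fun i _ => (exp_neg_le_quad (mul_nonneg hs (hx i))).trans ?_
          have := mul_le_mul_of_nonneg_left (hxB i) (hx i)
          have := mul_le_mul_of_nonneg_left this (sq_nonneg s)
          nlinarith
      _ = m - s * (∑ i, x i) + s^2/2 * ((∑ i, x i) * B) := by
          rw [sum_add_distrib, sum_sub_distrib, ← mul_sum, ← mul_sum, ← sum_mul]; simp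
      _ = _ := by field_simp; ring
  have hpow := pow_le_pow_left₀ (div_nonneg (sum_nonneg fun i _ => (Real.exp_pos _).le)
    (Nat.cast_nonneg _)) havg p
  rw [← Real.exp_nat_mul] at hpow
  have hmark : (#{I ∈ powersetCard p (univ : Finset (Fin m)) | ∑ i ∈ I, x i < T} : ℝ) ≤
      Real.exp (s * T) * eSum (fun i => Real.exp (-(s * x i))) p univ := by
    rw [card_eq_sum_ones, Nat.cast_sum, sum_filter, eSum, mul_sum]
    refine sum_le_sum fun I _ => ?_
    rw [← Real.exp_sum, ← Real.exp_add, sum_neg_distrib, ← mul_sum]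
    split_ifs with h
    · rw [Nat.cast_one, Real.one_le_exp_iff]
      nlinarith
    · exact (Real.exp_pos _).le
  refine hmark.trans ?_
  calc _ ≤ Real.exp (s*T) * ((Nat.choose #(univ : Finset (Fin m)) p : ℝ) *
        Real.exp (p * (-(s * (∑ i, x i) / m) + s^2/2 * ((∑ i, x i) * B / m)))) := by
        gcongr
        exact hmac.trans (by gcongr)
    _ = _ := by
        rw [card_powersetCard, mul_left_comm, ← Real.exp_add]
        congr 2
        ring

section
variable {n : ℕ} (A : Matrix (Fin n) (Fin n) ℝ)

lemma eig_set (μ : ℝ) (v : Fin n → ℝ) (hv : v ≠ 0) (h : A *ᵥ v = μ • v) :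
    Module.End.HasEigenvalue (Matrix.toLin' A) μ :=
  Module.End.hasEigenvalue_of_hasEigenvector
    (x := v) ⟨Module.End.mem_eigenspace_iff.2 (by simpa using h), hv⟩

lemma eig_vec_ne (hA : A.IsHermitian) (i : Fin n) : (hA.eigenvectorBasis i).ofLp ≠ 0 := by
  intro h
  have := hA.eigenvectorBasis.orthonormal.ne_zero i
  exact this (by ext j; simp [h])

lemma eig_finite : {μ : ℝ | Module.End.HasEigenvalue (Matrix.toLin' A) μ}.Finite :=
  Module.End.finite_hasEigenvalue _

lemma lamMax_attained (hn : 0 < n) (hA : A.IsHermitian) :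
    ∃ v : Fin n → ℝ, v ⬝ᵥ v = 1 ∧ A *ᵥ v = lamMax A • v := by
  have hne : {μ : ℝ | Module.End.HasEigenvalue (Matrix.toLin' A) μ}.Nonempty :=
    ⟨_, eig_set A _ _ (eig_vec_ne A hA ⟨0, hn⟩) (hA.mulVec_eigenvectorBasis _)⟩
  have h := hne.csSup_mem (eig_finite A)
  obtain ⟨w, hw⟩ := Module.End.HasEigenvalue.exists_hasEigenvector h
  have hw1 : A *ᵥ w = lamMax A • w := hw.apply_eq_smul
  have hw2 : w ≠ 0 := hw.2
  have hpos : 0 < w ⬝ᵥ w := by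
    refine lt_of_le_of_ne (sum_nonneg fun i _ => mul_self_nonneg _) (Ne.symm ?_)
    simpa using hw2
  refine ⟨(Real.sqrt (w ⬝ᵥ w))⁻¹ • w, ?_, ?_⟩
  · rw [smul_dotProduct, dotProduct_smul, smul_eq_mul, smul_eq_mul, ← mul_assoc, ← mul_inv,
      Real.mul_self_sqrt hpos.le, inv_mul_cancel₀ hpos.ne']
  · rw [mulVec_smul, hw1, smul_comm]

lemma le_lamMax (hA : A.IsHermitian) (v : Fin n → ℝ) :
    v ⬝ᵥ A *ᵥ v ≤ lamMax A * (v ⬝ᵥ v) := by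
  have hC : (lamMax A • (1 : Matrix (Fin n) (Fin n) ℝ) - A).IsHermitian := by
    refine IsHermitian.sub ?_ hA
    simp [IsHermitian, conjTranspose_smul]
  have hP : (lamMax A • (1 : Matrix (Fin n) (Fin n) ℝ) - A).PosSemidef := by
    rw [hC.posSemidef_iff_eigenvalues_nonneg]
    intro i
    have h := hC.mulVec_eigenvectorBasis i
    rw [sub_mulVec, smul_mulVec, one_mulVec] at h
    have h2 : A *ᵥ (hC.eigenvectorBasis i).ofLp
        = (lamMax A - hC.eigenvalues i) • (hC.eigenvectorBasis i).ofLp := by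
      rw [sub_smul, ← h]; simp
    have := le_csSup (eig_finite A).bddAbove (eig_set A _ _ (eig_vec_ne _ hC i) h2)
    change _ ≤ lamMax A at this
    simp only [Pi.zero_apply]
    linarith
  have := hP.dotProduct_mulVec_nonneg v
  rw [sub_mulVec, smul_mulVec, one_mulVec, dotProduct_sub, dotProduct_smul] at this
  simp at this
  linarith

end

/-- Lower bound on `λ_max` of a uniformly random column submatrix (matrix
Bernstein argument).  `Ψ S Sᵀ Ψᵀ = ∑_{i ∈ I} ψ_i ψ_iᵀ` for the selected column
set `I`; the probability is a counting fraction over size-`p` subsets. -/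
theorem column_subsample_lamMax_lower {n m p : ℕ} (hp : 1 ≤ p) (hpm : p ≤ m)
    (Ψ : Matrix (Fin n) (Fin m) ℝ) (δ : ℝ) (hδ0 : 0 < δ) (hδ1 : δ < 1)
    (B : ℝ) (hB : B = sSup (Set.range fun i : Fin m => ∑ a, (Ψ a i) ^ 2)) :
    (1 - δ) * ((Finset.powersetCard p (Finset.univ : Finset (Fin m))).card : ℝ) ≤
      (((Finset.powersetCard p (Finset.univ : Finset (Fin m))).filter fun I =>
          (p / m : ℝ) * lamMax (Ψ * Ψᵀ) -
              (4 / 3) * (lamMax (Ψ * Ψᵀ) / m) * Real.log (n / δ) -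
              Real.sqrt ((8 * p / m) * lamMax (Ψ * Ψᵀ) * B * Real.log (n / δ)) ≤
            lamMax (∑ i ∈ I, Matrix.vecMulVec (fun a => Ψ a i) (fun a => Ψ a i))).card : ℝ) := by
  have hm : (0:ℝ) < m := by exact_mod_cast (by omega : 0 < m)
  have hp0 : (0:ℝ) < p := by exact_mod_cast hp
  rcases Nat.eq_zero_or_pos n with rfl | hn
  · have h0 : ∀ A : Matrix (Fin 0) (Fin 0) ℝ, lamMax A = 0 := by
      intro A
      have : {μ : ℝ | Module.End.HasEigenvalue (Matrix.toLin' A) μ} = ∅ := by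
        ext μ
        simp only [Set.mem_ofPred_eq, Set.mem_empty_iff_false, iff_false]
        intro h
        obtain ⟨w, hw⟩ := h.exists_hasEigenvector
        exact hw.2 (Subsingleton.elim _ _)
      rw [lamMax, this, Real.sSup_empty]
    simp only [h0]
    simp
    nlinarith [(Nat.cast_nonneg (m.choose p) : (0:ℝ) ≤ _)]
  have hH : (Ψ * Ψᵀ).IsHermitian := by
    simpa using isHermitian_mul_conjTranspose_self Ψ
  obtain ⟨v, hv1, hv2⟩ := lamMax_attained _ hn hH
  set lam := lamMax (Ψ * Ψᵀ) with hlam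
  set x : Fin m → ℝ := fun i => ((fun a => Ψ a i) ⬝ᵥ v) ^ 2 with hxdef
  have hx : ∀ i, 0 ≤ x i := fun i => sq_nonneg _
  have hxB : ∀ i, x i ≤ B := by
    intro i
    have h1 : ∑ a, (Ψ a i)^2 ≤ B := by
      rw [hB]
      exact le_csSup (Set.finite_range _).bddAbove ⟨i, rfl⟩
    refine le_trans ?_ h1
    have := sum_mul_sq_le_sq_mul_sq univ (fun a => Ψ a i) v
    have h2 : ∑ a, v a ^ 2 = 1 := by rw [← hv1]; simp [dotProduct, sq]
    rw [h2, mul_one] at this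
    exact this
  have hsum : ∑ i, x i = lam := by
    have h1 : v ⬝ᵥ (Ψ * Ψᵀ) *ᵥ v = lam := by rw [hv2, dotProduct_smul, hv1]; simp
    rw [← h1, ← mulVec_mulVec, dotProduct_mulVec, ← mulVec_transpose]
    simp [dotProduct, mulVec, hxdef, sq]
  have hI : ∀ I : Finset (Fin m), ∑ i ∈ I, x i ≤
      lamMax (∑ i ∈ I, Matrix.vecMulVec (fun a => Ψ a i) (fun a => Ψ a i)) := by
    intro I
    have hh : (∑ i ∈ I, Matrix.vecMulVec (fun a => Ψ a i) (fun a => Ψ a i)).IsHermitian := by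
      ext a b
      simp [Matrix.sum_apply, vecMulVec_apply, mul_comm]
    have := le_lamMax _ hh v
    rw [hv1, mul_one] at this
    refine le_trans (le_of_eq ?_) this
    rw [sum_mulVec, dotProduct_sum]
    refine sum_congr rfl fun i _ => ?_
    rw [vecMulVec_mulVec]
    simp [hxdef, sq, dotProduct_comm]
  have hlam0 : 0 ≤ lam := hsum ▸ sum_nonneg fun i _ => hx i
  have hB0 : 0 ≤ B := (hx ⟨0, by omega⟩).trans (hxB _)
  set L := Real.log (n / δ) with hL
  have hn1 : (1:ℝ) ≤ n := by exact_mod_cast hn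
  have hLd : -Real.log δ ≤ L := by
    rw [hL, Real.log_div (by positivity) hδ0.ne']
    have := Real.log_nonneg hn1
    linarith
  have hlogd : Real.log δ < 0 := Real.log_neg hδ0 hδ1
  have hL0 : 0 < L := by linarith
  set V := p / m * lam * B with hV
  have hV0 : 0 ≤ V := by positivity
  set T := p / m * lam - Real.sqrt (8 * V * L) with hT
  -- bad event
  have hbad : (#{I ∈ powersetCard p (univ : Finset (Fin m)) | ∑ i ∈ I, x i < T} : ℝ) ≤
      δ * #(powersetCard p (univ : Finset (Fin m))) := by
    rcases hV0.eq_or_lt with h | hVpos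
    · have hl : lam = 0 := by
        by_contra hne
        have hBz : B = 0 := by
          have : p / m * lam ≠ 0 := by positivity
          exact (mul_eq_zero.1 h.symm).resolve_left this
        apply hne
        rw [← hsum]
        exact sum_eq_zero fun i _ => le_antisymm (hBz ▸ hxB i) (hx i)
      have hT0 : T = 0 := by rw [hT, ← h, hl]; simp
      rw [filter_false_of_mem]
      · simp; positivity
      · intro I _
        rw [hT0, not_lt]
        exact sum_nonneg fun i _ => hx i
    · have ht := tail_count hp hpm x B hx hxB (Real.sqrt (8 * V * L) / V) T (by positivity)
      refine ht.trans ?_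
      rw [mul_comm δ]
      gcongr
      rw [← Real.le_log_iff_exp_le hδ0, hsum, ← hV, hT]
      have hsq : Real.sqrt (8 * V * L) ^ 2 = 8 * V * L := Real.sq_sqrt (by positivity)
      have : Real.sqrt (8 * V * L) / V * (p / m * lam - Real.sqrt (8 * V * L)) -
          Real.sqrt (8 * V * L) / V * (p / m * lam) + (Real.sqrt (8 * V * L) / V)^2 / 2 * V
          = - (Real.sqrt (8 * V * L) ^ 2 / V / 2) := by field_simp; ring
      rw [this, hsq]
      have : 8 * V * L / V / 2 = 4 * L := by field_simp; ring
      linarith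
  have hsplit := card_filter_add_card_filter_not (s := powersetCard p (univ : Finset (Fin m)))
    (fun I => ∑ i ∈ I, x i < T)
  have hsplit' : (#{I ∈ powersetCard p (univ : Finset (Fin m)) | ∑ i ∈ I, x i < T} : ℝ) +
      (#{I ∈ powersetCard p (univ : Finset (Fin m)) | ¬ ∑ i ∈ I, x i < T} : ℝ) =
      #(powersetCard p (univ : Finset (Fin m))) := by exact_mod_cast hsplit
  have hmono : (#{I ∈ powersetCard p (univ : Finset (Fin m)) | ¬ ∑ i ∈ I, x i < T} : ℝ) ≤
      (((Finset.powersetCard p (Finset.univ : Finset (Fin m))).filter fun I =>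
          (p / m : ℝ) * lam - (4 / 3) * (lam / m) * L -
              Real.sqrt ((8 * p / m) * lam * B * L) ≤
            lamMax (∑ i ∈ I, Matrix.vecMulVec (fun a => Ψ a i) (fun a => Ψ a i))).card : ℝ) := by
    rw [Nat.cast_le]
    refine card_le_card (monotone_filter_right _ ?_)
    intro I _ h
    refine le_trans ?_ ((not_lt.1 h).trans (hI I))
    have e : (8 * p / m) * lam * B * L = 8 * V * L := by rw [hV]; ring
    rw [e, hT]
    have : 0 ≤ 4 / 3 * (lam / m) * L := by positivity
    linarith
  linarith
end

section
/- Let (Ω, ρ) be a probability space and φ : 𝒳 × Ω → ℝ measurable with B := sup_{x∈𝒳, ω} |φ(x,ω)| < ∞. Given points x_1,...,x_n ∈ 𝒳, let K ∈ ℝ^{n×n} with K_{ij} = E_{ω∼ρ}[φ(x_i,ω)φ(x_j,ω)], and let Z ∈ ℝ^{n×p} have entries Z_{ik} = φ(x_i, ω_k)/√p for i.i.d. draws ω_1,...,ω_p ∼ ρ. Fix α ∈ (0,1) and δ ∈ (0,1). If p ≥ (2/α)(1/α + 2/3)·(n B²/‖K‖)·log(2n/δ), then with probability at least 1 − δ,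 (1−α)‖K‖ ≤ ‖Z Zᵀ‖ ≤ (1+α)‖K‖. -/
open Matrix MeasureTheory

section GT
variable {n : Type*} [Fintype n] [DecidableEq n]

lemma rf_trace_mul_le (X Y : Matrix n n ℝ) :
    (X * Y).trace ≤ ((X * Xᵀ).trace + (Yᵀ * Y).trace) / 2 := by
  simp only [Matrix.trace, Matrix.diag, Matrix.mul_apply, Matrix.transpose_apply]
  rw [← Finset.sum_add_distrib, Finset.sum_div]
  refine Finset.sum_le_sum fun i _ => ?_
  rw [← Finset.sum_add_distrib, Finset.sum_div]
  refine Finset.sum_le_sum fun j _ => ?_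
  nlinarith [sq_nonneg (X i j - Y j i)]

lemma rf_mul_pow_shift (A B : Matrix n n ℝ) (k : ℕ) : (A * B) ^ k * A = A * (B * A) ^ k := by
  induction k with
  | zero => simp
  | succ k ih => rw [pow_succ', pow_succ', mul_assoc, ih]; simp only [mul_assoc]

lemma rf_trace_pow_comm (A B : Matrix n n ℝ) (k : ℕ) :
    ((A * B) ^ k).trace = ((B * A) ^ k).trace := by
  cases k with
  | zero => simp
  | succ k =>
    rw [pow_succ, ← mul_assoc, rf_mul_pow_shift, mul_assoc, Matrix.trace_mul_comm, mul_assoc,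
      ← pow_succ]

lemma rf_CD (k : ℕ) :
    (∀ X : Matrix n n ℝ, (X ^ (2 ^ (k+1))).trace ≤ ((X * Xᵀ) ^ (2 ^ k)).trace) ∧
    (∀ P Q : Matrix n n ℝ, Pᵀ = P → Qᵀ = Q →
      ((P * Q) ^ (2 ^ k)).trace ≤ (P ^ (2 ^ k) * Q ^ (2 ^ k)).trace) := by
  induction k with
  | zero =>
    refine ⟨fun X => ?_, fun P Q _ _ => by simp⟩
    have h := rf_trace_mul_le X X
    rw [Matrix.trace_mul_comm Xᵀ X] at h
    simp only [zero_add, pow_one, pow_zero, pow_two]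
    linarith
  | succ k ih =>
    obtain ⟨ihD, ihC⟩ := ih
    refine ⟨fun X => ?_, fun P Q hP hQ => ?_⟩
    · have hPt : (Xᵀ * X)ᵀ = Xᵀ * X := by simp
      have hQt : (X * Xᵀ)ᵀ = X * Xᵀ := by simp
      calc (X ^ (2 ^ (k+1+1))).trace = ((X ^ 2) ^ (2 ^ (k+1))).trace := by
            rw [← pow_mul, ← pow_succ']
        _ ≤ (((X ^ 2) * (X ^ 2)ᵀ) ^ (2 ^ k)).trace := ihD _
        _ = ((X * (X * Xᵀ * Xᵀ)) ^ (2 ^ k)).trace := by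
            rw [Matrix.transpose_pow, pow_two, pow_two]; simp only [mul_assoc]
        _ = (((X * Xᵀ) * (Xᵀ * X)) ^ (2 ^ k)).trace := by
            rw [rf_trace_pow_comm]; simp only [mul_assoc]
        _ ≤ ((X * Xᵀ) ^ (2 ^ k) * (Xᵀ * X) ^ (2 ^ k)).trace := ihC _ _ hQt hPt
        _ ≤ _ := by
            have h := rf_trace_mul_le ((X * Xᵀ) ^ (2 ^ k)) ((Xᵀ * X) ^ (2 ^ k))
            rw [Matrix.transpose_pow, Matrix.transpose_pow, hPt, hQt, ← pow_add, ← pow_add,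
              ← two_mul, ← pow_succ', rf_trace_pow_comm Xᵀ X] at h
            linarith
    · calc ((P * Q) ^ (2 ^ (k+1))).trace ≤ (((P * Q) * (P * Q)ᵀ) ^ (2 ^ k)).trace := ihD _
        _ = ((P * (Q * Q * P)) ^ (2 ^ k)).trace := by
            rw [Matrix.transpose_mul, hP, hQ]; simp only [mul_assoc]
        _ = (((Q ^ 2) * (P ^ 2)) ^ (2 ^ k)).trace := by
            rw [rf_trace_pow_comm, pow_two, pow_two]; simp only [mul_assoc]
        _ = (((P ^ 2) * (Q ^ 2)) ^ (2 ^ k)).trace := rf_trace_pow_comm _ _ _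
        _ ≤ ((P ^ 2) ^ (2 ^ k) * (Q ^ 2) ^ (2 ^ k)).trace :=
            ihC _ _ (by rw [Matrix.transpose_pow, hP]) (by rw [Matrix.transpose_pow, hQ])
        _ = _ := by rw [← pow_mul, ← pow_mul, ← pow_succ']
end GT

section LT
set_option linter.unusedSectionVars false
open NormedSpace Filter Topology
variable {A : Type*} [NormedRing A] [NormedAlgebra ℝ A] [CompleteSpace A] [NormOneClass A]

lemma rf_norm_exp_le (x : A) : ‖exp x‖ ≤ Real.exp ‖x‖ := by
  have h := exp_series_hasSum_exp' (𝕂 := ℝ) x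
  have h2 := exp_series_hasSum_exp' (𝕂 := ℝ) (‖x‖)
  rw [← Real.exp_eq_exp_ℝ] at h2
  refine h.norm_le_of_bounded h2 fun i => ?_
  rw [norm_smul, norm_inv, smul_eq_mul]
  simp only [RCLike.norm_natCast]
  gcongr
  exact norm_pow_le x i

lemma rf_pow_sub (U V : A) (r : ℝ) (hr : 1 ≤ r) (hU : ‖U‖ ≤ r) (hV : ‖V‖ ≤ r) (m : ℕ) :
    ‖U ^ m - V ^ m‖ ≤ m * ‖U - V‖ * r ^ m := by
  induction m with
  | zero => simp
  | succ m ih =>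
    have : U ^ (m+1) - V ^ (m+1) = U ^ m * (U - V) + (U ^ m - V ^ m) * V := by
      rw [pow_succ, pow_succ]; noncomm_ring
    rw [this]
    have h1 : ‖U ^ m‖ ≤ r ^ m := (norm_pow_le U m).trans (by gcongr)
    have hrm : r ^ m ≤ r ^ (m+1) := pow_le_pow_right₀ hr (Nat.le_succ m)
    calc _ ≤ ‖U ^ m‖ * ‖U - V‖ + ‖U ^ m - V ^ m‖ * ‖V‖ :=
          (norm_add_le _ _).trans (add_le_add (norm_mul_le _ _) (norm_mul_le _ _))
      _ ≤ r ^ (m+1) * ‖U - V‖ + (m * ‖U - V‖ * r ^ m) * r := by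
          gcongr
          exact h1.trans hrm
      _ = _ := by push_cast; ring

lemma rf_lie_trotter (X Y : A) :
    Tendsto (fun m : ℕ => (exp ((m : ℝ)⁻¹ • X) * exp ((m : ℝ)⁻¹ • Y)) ^ m) atTop
      (𝓝 (exp (X + Y))) := by
  have hd : ∀ Z : A, HasDerivAt (fun t : ℝ => exp (t • Z)) Z 0 := fun Z => by
    have := hasDerivAt_exp_smul_const (𝕂 := ℝ) Z (0:ℝ)
    simpa using this
  have hf : HasDerivAt (fun t : ℝ => exp (t • X) * exp (t • Y) - exp (t • (X + Y))) 0 0 := by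
    have := ((hd X).mul (hd Y)).sub (hd (X + Y))
    simp only [zero_smul, exp_zero, mul_one, one_mul, sub_self] at this
    exact this
  have hlim : Tendsto (fun m : ℕ => (m : ℝ) * ‖exp ((m : ℝ)⁻¹ • X) * exp ((m : ℝ)⁻¹ • Y)
      - exp ((m : ℝ)⁻¹ • (X + Y))‖) atTop (𝓝 0) := by
    have h1 := hasDerivAt_iff_tendsto_slope_zero.1 hf
    have h2 : Tendsto (fun m : ℕ => (m : ℝ)⁻¹) atTop (𝓝[≠] 0) := by
      refine tendsto_nhdsWithin_iff.2 ⟨tendsto_inv_atTop_nhds_zero_nat, ?_⟩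
      filter_upwards [eventually_ge_atTop 1] with m hm
      have : (0:ℝ) < m := by exact_mod_cast hm
      exact (inv_pos.2 this).ne'
    have h3 := (h1.comp h2).norm
    simpa [Function.comp_def, norm_smul] using h3
  rw [tendsto_iff_norm_sub_tendsto_zero]
  set C := ‖X‖ + ‖Y‖
  have hlim2 := hlim.mul_const (Real.exp C)
  rw [zero_mul] at hlim2
  refine squeeze_zero' (Eventually.of_forall fun _ => norm_nonneg _) ?_ hlim2
  filter_upwards [eventually_ge_atTop 1] with m hm
  have hm0 : (0:ℝ) < m := by exact_mod_cast hm
  have hV : exp (X + Y) = (exp ((m : ℝ)⁻¹ • (X + Y))) ^ m := by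
    let _ : NormedAlgebra ℚ A := NormedAlgebra.restrictScalars ℚ ℝ A
    rw [← NormedSpace.exp_nsmul, ← Nat.cast_smul_eq_nsmul ℝ, smul_smul, mul_inv_cancel₀ hm0.ne', one_smul]
  rw [hV]
  have hC : 0 ≤ C := by positivity
  have hn : ∀ Z : A, ‖exp ((m : ℝ)⁻¹ • Z)‖ ≤ Real.exp ((m : ℝ)⁻¹ * ‖Z‖) := fun Z => by
    refine (rf_norm_exp_le _).trans_eq ?_
    rw [norm_smul, norm_inv, Real.norm_natCast]
  refine (rf_pow_sub _ _ (Real.exp ((m : ℝ)⁻¹ * C)) ?_ ?_ ?_ m).trans_eq ?_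
  · exact Real.one_le_exp (by positivity)
  · refine (norm_mul_le _ _).trans ?_
    rw [mul_add, Real.exp_add]
    exact mul_le_mul (hn X) (hn Y) (norm_nonneg _) (Real.exp_pos _).le
  · refine (hn _).trans ?_
    gcongr
    exact norm_add_le _ _
  · rw [← Real.exp_nat_mul, ← mul_assoc, mul_inv_cancel₀ hm0.ne', one_mul]
end LT

section GT2
open NormedSpace Filter Topology
variable {n : Type*} [Fintype n] [DecidableEq n]

lemma rf_golden_thompson (X Y : Matrix n n ℝ) (hX : Xᵀ = X) (hY : Yᵀ = Y) :
    (exp (X + Y)).trace ≤ (exp X * exp Y).trace := by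
  rcases isEmpty_or_nonempty n with hn | hn
  · simp [Matrix.trace]
  let _ := Matrix.linftyOpNormedRing (n := n) (α := ℝ)
  let _ := Matrix.linftyOpNormedAlgebra (n := n) (R := ℝ) (α := ℝ)
  have : NormOneClass (Matrix n n ℝ) := Matrix.linfty_opNormOneClass
  have h := rf_lie_trotter X Y
  have h2 : Tendsto (fun k : ℕ => 2 ^ k) atTop (atTop : Filter ℕ) :=
    tendsto_pow_atTop_atTop_of_one_lt (by norm_num)
  have h3 := h.comp h2
  have hc : Continuous (fun M : Matrix n n ℝ => M.trace) := continuous_id.matrix_trace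
  refine le_of_tendsto ((hc.tendsto _).comp h3) (Eventually.of_forall fun k => ?_)
  simp only [Function.comp]
  have hs : ∀ Z : Matrix n n ℝ, Zᵀ = Z → ∀ c : ℝ, (exp (c • Z))ᵀ = exp (c • Z) := fun Z hZ c => by
    rw [← Matrix.exp_transpose, Matrix.transpose_smul, hZ]
  have hm0 : ((2 ^ k : ℕ) : ℝ) ≠ 0 := by positivity
  have hV : ∀ Z : Matrix n n ℝ, (exp ((((2 ^ k : ℕ) : ℝ))⁻¹ • Z)) ^ (2 ^ k) = exp Z := fun Z => by
    rw [← Matrix.exp_nsmul, ← Nat.cast_smul_eq_nsmul ℝ, smul_smul, mul_inv_cancel₀ hm0, one_smul]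
  refine ((rf_CD k).2 _ _ (hs X hX _) (hs Y hY _)).trans_eq ?_
  rw [hV, hV]
end GT2

section LM
open NormedSpace Filter Topology
variable {n : Type*} [Fintype n] [DecidableEq n]
set_option linter.unusedSectionVars false

lemma rf_eig_iff (M : Matrix n n ℝ) (μ : ℝ) :
    Module.End.HasEigenvalue (Matrix.toLin' M) μ ↔ ∃ v : n → ℝ, v ≠ 0 ∧ M *ᵥ v = μ • v := by
  constructor
  · intro h
    obtain ⟨v, hv⟩ := h.exists_hasEigenvector
    exact ⟨v, hv.2, by simpa using hv.apply_eq_smul⟩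
  · rintro ⟨v, hv, h⟩
    exact Module.End.hasEigenvalue_of_hasEigenvector
      (x := v) ⟨Module.End.mem_eigenspace_iff.2 (by simpa using h), hv⟩

lemma rf_le_lamMax (M : Matrix n n ℝ) (μ : ℝ) (v : n → ℝ) (hv : v ≠ 0) (h : M *ᵥ v = μ • v) :
    μ ≤ lamMax M :=
  le_csSup (Module.End.finite_hasEigenvalue _).bddAbove ((rf_eig_iff M μ).2 ⟨v, hv, h⟩)

lemma rf_exists_top (M : Matrix n n ℝ) (hM : Mᵀ = M) [Nonempty n] :
    ∃ μ : ℝ, (∃ v : n → ℝ, v ≠ 0 ∧ M *ᵥ v = μ • v) ∧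
      ∀ v : n → ℝ, v ⬝ᵥ (M *ᵥ v) ≤ μ * (v ⬝ᵥ v) := by
  have hs : (toEuclideanLin M).IsSymmetric := by
    rw [isSymmetric_toEuclideanLin_iff]
    rwa [Matrix.IsHermitian, Matrix.conjTranspose_eq_transpose_of_trivial]
  refine ⟨⨆ x : {x : EuclideanSpace ℝ n // x ≠ 0},
        RCLike.re (inner ℝ (toEuclideanLin M x.1) x.1) / ‖x.1‖ ^ 2, ?_, ?_⟩
  · have h := hs.hasEigenvalue_iSup_of_finiteDimensional
    obtain ⟨v, hv⟩ := h.exists_hasEigenvector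
    refine ⟨v.ofLp, fun h0 => hv.2 ((WithLp.ofLp_eq_zero 2).1 h0), ?_⟩
    have := congrArg WithLp.ofLp hv.apply_eq_smul
    simpa using this
  · intro v
    by_cases hv : v = 0
    · simp [hv]
    have hw : (WithLp.toLp 2 v : EuclideanSpace ℝ n) ≠ 0 := by simpa using hv
    have hn : ‖(WithLp.toLp 2 v : EuclideanSpace ℝ n)‖ ^ 2 = v ⬝ᵥ v := by
      rw [EuclideanSpace.norm_sq_eq]; simp [dotProduct, pow_two]
    have hpos : 0 < v ⬝ᵥ v := by rw [← hn]; have := norm_pos_iff.2 hw; positivity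
    rw [← div_le_iff₀ hpos]
    have hb : BddAbove (Set.range fun x : {x : EuclideanSpace ℝ n // x ≠ 0} =>
        RCLike.re (inner ℝ (toEuclideanLin M x.1) x.1) / ‖x.1‖ ^ 2) := by
      have := (toEuclideanCLM (n := n) (𝕜 := ℝ) M).bddAbove_rayleighQuotient
      obtain ⟨c, hc⟩ := this
      refine ⟨c, ?_⟩
      rintro _ ⟨x, rfl⟩
      refine le_trans ?_ (hc ⟨x.1, rfl⟩)
      exact le_abs_self _
    refine le_trans (le_of_eq ?_) (le_ciSup hb ⟨_, hw⟩)
    simp only [hn]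
    congr 1

lemma rf_lamMax_spec (M : Matrix n n ℝ) (hM : Mᵀ = M) [Nonempty n] :
    (∃ v : n → ℝ, v ⬝ᵥ v = 1 ∧ M *ᵥ v = lamMax M • v) ∧
      ∀ v : n → ℝ, v ⬝ᵥ (M *ᵥ v) ≤ lamMax M * (v ⬝ᵥ v) := by
  obtain ⟨μ, ⟨v, hv, hv2⟩, h⟩ := rf_exists_top M hM
  have hpos : ∀ v : n → ℝ, v ≠ 0 → 0 < v ⬝ᵥ v := fun v hv => by
    have h0 : 0 ≤ v ⬝ᵥ v := Finset.sum_nonneg fun i _ => mul_self_nonneg _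
    exact lt_of_le_of_ne h0 fun h1 => hv (dotProduct_self_eq_zero.1 h1.symm)
  have hle := rf_le_lamMax M μ v hv hv2
  have hge : lamMax M ≤ μ := by
    refine csSup_le ⟨μ, (rf_eig_iff M μ).2 ⟨v, hv, hv2⟩⟩ ?_
    rintro ν hν
    obtain ⟨w, hw, hw2⟩ := (rf_eig_iff M ν).1 hν
    have := h w
    rw [hw2, dotProduct_smul, smul_eq_mul] at this
    exact le_of_mul_le_mul_right this (hpos w hw)
  have heq : lamMax M = μ := le_antisymm hge hle
  rw [heq]
  refine ⟨⟨(Real.sqrt (v ⬝ᵥ v))⁻¹ • v, ?_, ?_⟩, h⟩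
  · have := hpos v hv
    rw [smul_dotProduct, dotProduct_smul, smul_eq_mul, smul_eq_mul, ← mul_assoc, ← mul_inv,
      Real.mul_self_sqrt this.le, inv_mul_cancel₀ this.ne']
  · rw [mulVec_smul, hv2, smul_comm]

lemma rf_exp_gram (A : Matrix n n ℝ) (hA : Aᵀ = A) :
    ∃ G : Matrix n n ℝ, exp A = G * Gᵀ := by
  refine ⟨exp ((2:ℝ)⁻¹ • A), ?_⟩
  rw [← Matrix.exp_transpose, transpose_smul, hA, ← Matrix.exp_add_of_commute _ _ (Commute.refl _),
    ← add_smul]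
  norm_num

lemma rf_hasSum_exp (A : Matrix n n ℝ) :
    HasSum (fun k : ℕ => ((k.factorial : ℝ)⁻¹) • A ^ k) (exp A) := by
  let _ := Matrix.linftyOpNormedRing (n := n) (α := ℝ)
  let _ := Matrix.linftyOpNormedAlgebra (n := n) (R := ℝ) (α := ℝ)
  exact exp_series_hasSum_exp' (𝕂 := ℝ) A

lemma rf_continuous_exp : Continuous (exp : Matrix n n ℝ → Matrix n n ℝ) := by
  let _ := Matrix.linftyOpNormedRing (n := n) (α := ℝ)
  let _ := Matrix.linftyOpNormedAlgebra (n := n) (R := ℝ) (α := ℝ)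
  let _ : NormedAlgebra ℚ (Matrix n n ℝ) := NormedAlgebra.restrictScalars ℚ ℝ _
  exact exp_continuous

lemma rf_hasSum_real (s : ℝ) : HasSum (fun k : ℕ => ((k.factorial : ℝ)⁻¹) * s ^ k) (Real.exp s) := by
  have h2 := exp_series_hasSum_exp' (𝕂 := ℝ) s
  rwa [← Real.exp_eq_exp_ℝ] at h2

lemma rf_exp_mulVec (A : Matrix n n ℝ) (μ : ℝ) (v : n → ℝ) (h : A *ᵥ v = μ • v) :
    exp A *ᵥ v = Real.exp μ • v := by
  have hk : ∀ k : ℕ, (A ^ k) *ᵥ v = μ ^ k • v := fun k => by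
    induction k with
    | zero => simp
    | succ k ih => rw [pow_succ, ← mulVec_mulVec, h, mulVec_smul, ih, smul_smul, pow_succ']
  have h1 := (rf_hasSum_exp A).map (AddMonoidHom.mk' (fun M : Matrix n n ℝ => M *ᵥ v)
    (fun a b => add_mulVec a b v)) (continuous_id.matrix_mulVec continuous_const)
  have h2 := (rf_hasSum_real μ).smul_const v
  refine h1.unique ?_
  convert h2 using 2 with k
  simp [smul_mulVec, hk, smul_smul]

lemma rf_exp_le_trace (A : Matrix n n ℝ) (hA : Aᵀ = A) (μ : ℝ) (v : n → ℝ) (hv : v ⬝ᵥ v = 1)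
    (h : A *ᵥ v = μ • v) : Real.exp μ ≤ (exp A).trace := by
  have h1 := rf_exp_mulVec A μ v h
  have h2 : v ⬝ᵥ (exp A *ᵥ v) = Real.exp μ := by
    rw [h1, dotProduct_smul, hv, smul_eq_mul, mul_one]
  obtain ⟨G, hG⟩ := rf_exp_gram A hA
  rw [← h2, hG]
  have h3 : v ⬝ᵥ ((G * Gᵀ) *ᵥ v) = ∑ k, (∑ i, v i * G i k) ^ 2 := by
    rw [← mulVec_mulVec, dotProduct_mulVec]
    simp [dotProduct, vecMul, mulVec, pow_two, mul_comm]
  rw [h3]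
  have h4 : (G * Gᵀ).trace = ∑ k, ∑ i, G i k ^ 2 := by
    rw [Finset.sum_comm]
    simp [Matrix.trace, Matrix.mul_apply, pow_two]
  rw [h4]
  refine Finset.sum_le_sum fun k _ => ?_
  have := Finset.sum_mul_sq_le_sq_mul_sq Finset.univ v (fun i => G i k)
  have hv' : ∑ i, v i ^ 2 = 1 := by rw [← hv]; simp [dotProduct, pow_two]
  rwa [hv', one_mul] at this

lemma rf_exp_idem (P : Matrix n n ℝ) (hP : P * P = P) (s : ℝ) :
    exp (s • P) = 1 + (Real.exp s - 1) • P := by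
  refine (rf_hasSum_exp _).unique ?_
  have h1 := (rf_hasSum_real s).smul_const P
  have h2 : HasSum (fun k : ℕ => if k = 0 then (1 - P) else 0) (1 - P) := hasSum_ite_eq 0 _
  have h3 := h1.add h2
  have e : Real.exp s • P + (1 - P) = 1 + (Real.exp s - 1) • P := by
    rw [sub_smul, one_smul]; abel
  rw [e] at h3
  convert h3 using 2 with k
  rcases k with _ | k
  · simp
  · have : ∀ k : ℕ, P ^ (k+1) = P := fun k => by
      induction k with
      | zero => simp
      | succ k ih => rw [pow_succ, ih, hP]
    rw [smul_pow, this, smul_smul]; simp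

lemma rf_exp_slope (θ r R : ℝ) (hr : 0 < r) (hrR : r ≤ R) :
    (Real.exp (θ * r) - 1) / r ≤ (Real.exp (θ * R) - 1) / R := by
  have hR : 0 < R := hr.trans_le hrR
  have h := convexOn_exp.2 (Set.mem_univ (θ * R)) (Set.mem_univ 0)
    (show 0 ≤ r / R by positivity) (show 0 ≤ 1 - r / R by rw [sub_nonneg, div_le_one hR]; exact hrR) (by ring)
  have e : (r / R) • (θ * R) + (1 - r / R) • (0:ℝ) = θ * r := by
    simp; field_simp
  rw [e, Real.exp_zero, smul_eq_mul, smul_eq_mul] at h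
  rw [div_le_iff₀ hr]
  have : (Real.exp (θ * R) - 1) / R * r = r / R * Real.exp (θ * R) + (1 - r / R) * 1 - 1 := by
    field_simp; ring
  linarith

lemma rf_step (A : Matrix n n ℝ) (hA : Aᵀ = A) (ξ : n → ℝ) (θ R : ℝ)
    (hR : ξ ⬝ᵥ ξ ≤ R) :
    (exp (A + θ • vecMulVec ξ ξ)).trace ≤
      (exp A).trace + (Real.exp (θ * R) - 1) / R * (ξ ⬝ᵥ (exp A *ᵥ ξ)) := by
  have h0 : 0 ≤ ξ ⬝ᵥ ξ := Finset.sum_nonneg fun i _ => mul_self_nonneg _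
  rcases h0.eq_or_lt with h | hpos
  · have : ξ = 0 := dotProduct_self_eq_zero.1 h.symm
    subst this
    simp
  set r := ξ ⬝ᵥ ξ with hr
  have hH : (θ • vecMulVec ξ ξ)ᵀ = θ • vecMulVec ξ ξ := by
    rw [transpose_smul, transpose_vecMulVec]
  refine (rf_golden_thompson A _ hA hH).trans ?_
  have hP : (r⁻¹ • vecMulVec ξ ξ) * (r⁻¹ • vecMulVec ξ ξ) = r⁻¹ • vecMulVec ξ ξ := by
    rw [smul_mul_assoc, mul_smul_comm, vecMulVec_mul_vecMulVec, ← hr, vecMulVec_smul, smul_smul,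
      smul_smul]
    congr 1
    field_simp
  have he : θ • vecMulVec ξ ξ = (θ * r) • (r⁻¹ • vecMulVec ξ ξ) := by
    rw [smul_smul]; congr 1; field_simp
  have hq : 0 ≤ ξ ⬝ᵥ (exp A *ᵥ ξ) := by
    obtain ⟨G, hG⟩ := rf_exp_gram A hA
    rw [hG, ← mulVec_mulVec, dotProduct_mulVec, ← mulVec_transpose]
    exact Finset.sum_nonneg fun i _ => mul_self_nonneg _
  have ht : (exp A * vecMulVec ξ ξ).trace = ξ ⬝ᵥ (exp A *ᵥ ξ) := by
    rw [mul_vecMulVec, trace_vecMulVec, dotProduct_comm]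
  rw [he, rf_exp_idem _ hP, mul_add, mul_one, trace_add, smul_smul, mul_smul_comm, trace_smul, ht,
    smul_eq_mul]
  gcongr
  have := rf_exp_slope θ r R hpos hR
  rwa [div_eq_mul_inv] at this
end LM

section PR
open NormedSpace
variable {Ω : Type*} [MeasurableSpace Ω] {n : ℕ}
set_option linter.unusedSectionVars false

lemma rf_meas_trace_exp {Ω' : Type*} [MeasurableSpace Ω'] (M : Ω' → Matrix (Fin n) (Fin n) ℝ)
    (hM : ∀ i j, Measurable fun ω => M ω i j) : Measurable fun ω => (exp (M ω)).trace := by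
  have hc : Continuous fun f : Fin n → Fin n → ℝ => (exp (Matrix.of f)).trace :=
    (rf_continuous_exp.comp continuous_id).matrix_trace
  exact hc.measurable.comp
    (measurable_pi_iff.2 fun i => measurable_pi_iff.2 fun j => hM i j)

lemma rf_trace_exp_nonneg (A : Matrix (Fin n) (Fin n) ℝ) (hA : Aᵀ = A) : 0 ≤ (exp A).trace := by
  obtain ⟨G, hG⟩ := rf_exp_gram A hA
  rw [hG]
  simp only [Matrix.trace, Matrix.diag, Matrix.mul_apply, transpose_apply]
  exact Finset.sum_nonneg fun i _ => Finset.sum_nonneg fun j _ => mul_self_nonneg _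

lemma rf_quad_nonneg (A : Matrix (Fin n) (Fin n) ℝ) (hA : Aᵀ = A) (v : Fin n → ℝ) :
    0 ≤ v ⬝ᵥ (exp A *ᵥ v) := by
  obtain ⟨G, hG⟩ := rf_exp_gram A hA
  rw [hG, ← mulVec_mulVec, dotProduct_mulVec, ← mulVec_transpose]
  exact Finset.sum_nonneg fun i _ => mul_self_nonneg _

lemma rf_integral_quad (ρ : Measure Ω) [IsProbabilityMeasure ρ] (ξ : Ω → Fin n → ℝ)
    (hinteg : ∀ i j, Integrable (fun ω => ξ ω i * ξ ω j) ρ)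
    (K : Matrix (Fin n) (Fin n) ℝ) (hK : ∀ i j, K i j = ∫ ω, ξ ω i * ξ ω j ∂ρ)
    (E : Matrix (Fin n) (Fin n) ℝ) :
    Integrable (fun ω => ξ ω ⬝ᵥ (E *ᵥ ξ ω)) ρ ∧
      ∫ ω, ξ ω ⬝ᵥ (E *ᵥ ξ ω) ∂ρ = ∑ i, ∑ j, E i j * K i j := by
  have e : (fun ω => ξ ω ⬝ᵥ (E *ᵥ ξ ω)) = fun ω => ∑ i, ∑ j, E i j * (ξ ω i * ξ ω j) := by
    funext ω
    simp only [dotProduct, mulVec, Finset.mul_sum]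
    refine Finset.sum_congr rfl fun i _ => Finset.sum_congr rfl fun j _ => by ring
  have hi : ∀ i j, Integrable (fun ω => E i j * (ξ ω i * ξ ω j)) ρ :=
    fun i j => (hinteg i j).const_mul _
  rw [e]
  refine ⟨integrable_finsetSum _ fun i _ => integrable_finsetSum _ fun j _ => hi i j, ?_⟩
  rw [integral_finsetSum _ fun i _ => integrable_finsetSum _ fun j _ => hi i j]
  refine Finset.sum_congr rfl fun i _ => ?_
  rw [integral_finsetSum _ fun j _ => hi i j]
  refine Finset.sum_congr rfl fun j _ => ?_
  rw [integral_const_mul, hK]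

lemma rf_sum_le (K : Matrix (Fin n) (Fin n) ℝ) (lam : ℝ)
    (hq : ∀ v : Fin n → ℝ, v ⬝ᵥ (K *ᵥ v) ≤ lam * (v ⬝ᵥ v))
    (A : Matrix (Fin n) (Fin n) ℝ) (hA : Aᵀ = A) :
    ∑ i, ∑ j, exp A i j * K i j ≤ lam * (exp A).trace := by
  obtain ⟨G, hG⟩ := rf_exp_gram A hA
  rw [hG]
  have h1 : ∑ i, ∑ j, (G * Gᵀ) i j * K i j = ∑ k, (fun i => G i k) ⬝ᵥ (K *ᵥ fun i => G i k) := by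
    simp only [dotProduct, mulVec, Matrix.mul_apply, transpose_apply, Finset.mul_sum,
      Finset.sum_mul]
    rw [Finset.sum_comm' (t' := Finset.univ) (s' := fun _ => Finset.univ) (by simp)]
    conv_rhs => rw [Finset.sum_comm]
    rw [Finset.sum_comm]
    refine Finset.sum_congr rfl fun i _ => ?_
    rw [Finset.sum_comm]
    refine Finset.sum_congr rfl fun i _ => Finset.sum_congr rfl fun j _ => by ring
  have h2 : (G * Gᵀ).trace = ∑ k, (fun i => G i k) ⬝ᵥ (fun i => G i k) := by
    simp only [dotProduct, Matrix.trace, Matrix.diag, Matrix.mul_apply, transpose_apply]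
    rw [Finset.sum_comm]
  rw [h1, h2, Finset.mul_sum]
  exact Finset.sum_le_sum fun k _ => hq _

lemma rf_lintegral_step (ρ : Measure Ω) [IsProbabilityMeasure ρ] (ξ : Ω → Fin n → ℝ)
    (hinteg : ∀ i j, Integrable (fun ω => ξ ω i * ξ ω j) ρ)
    (K : Matrix (Fin n) (Fin n) ℝ) (hK : ∀ i j, K i j = ∫ ω, ξ ω i * ξ ω j ∂ρ)
    (lam θ R : ℝ) (hlam : 0 ≤ lam) (hθ : 0 ≤ θ) (hR0 : 0 < R) (hR : ∀ ω, ξ ω ⬝ᵥ ξ ω ≤ R)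
    (hq : ∀ v : Fin n → ℝ, v ⬝ᵥ (K *ᵥ v) ≤ lam * (v ⬝ᵥ v))
    (A : Matrix (Fin n) (Fin n) ℝ) (hA : Aᵀ = A) :
    ∫⁻ ω, ENNReal.ofReal (exp (A + θ • vecMulVec (ξ ω) (ξ ω))).trace ∂ρ ≤
      ENNReal.ofReal (1 + (Real.exp (θ * R) - 1) / R * lam) * ENNReal.ofReal (exp A).trace := by
  have hk : 0 ≤ (Real.exp (θ * R) - 1) / R :=
    div_nonneg (sub_nonneg.2 (Real.one_le_exp (by positivity))) hR0.le
  obtain ⟨hi, hv⟩ := rf_integral_quad ρ ξ hinteg K hK (exp A)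
  have ht := rf_trace_exp_nonneg A hA
  calc _ ≤ ∫⁻ ω, ENNReal.ofReal ((exp A).trace +
          (Real.exp (θ * R) - 1) / R * (ξ ω ⬝ᵥ (exp A *ᵥ ξ ω))) ∂ρ :=
        lintegral_mono fun ω => ENNReal.ofReal_le_ofReal (rf_step A hA (ξ ω) θ R (hR ω))
    _ = ENNReal.ofReal (∫ ω, ((exp A).trace +
          (Real.exp (θ * R) - 1) / R * (ξ ω ⬝ᵥ (exp A *ᵥ ξ ω))) ∂ρ) := by
        rw [ofReal_integral_eq_lintegral_ofReal]
        · exact (integrable_const _).add (hi.const_mul _)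
        · exact Filter.Eventually.of_forall fun ω =>
            add_nonneg ht (mul_nonneg hk (rf_quad_nonneg A hA _))
    _ ≤ _ := by
        rw [← ENNReal.ofReal_mul (by positivity)]
        refine ENNReal.ofReal_le_ofReal ?_
        rw [integral_add (integrable_const _) (hi.const_mul _), integral_const_mul, hv]
        have := mul_le_mul_of_nonneg_left (rf_sum_le K lam hq A hA) hk
        simp only [integral_const, probReal_univ, one_smul]
        linarith

lemma rf_lintegral_pi (ρ : Measure Ω) [IsProbabilityMeasure ρ] (ξ : Ω → Fin n → ℝ)
    (hm : ∀ i, Measurable fun ω => ξ ω i)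
    (hinteg : ∀ i j, Integrable (fun ω => ξ ω i * ξ ω j) ρ)
    (K : Matrix (Fin n) (Fin n) ℝ) (hK : ∀ i j, K i j = ∫ ω, ξ ω i * ξ ω j ∂ρ)
    (lam θ R : ℝ) (hlam : 0 ≤ lam) (hθ : 0 ≤ θ) (hR0 : 0 < R) (hR : ∀ ω, ξ ω ⬝ᵥ ξ ω ≤ R)
    (hq : ∀ v : Fin n → ℝ, v ⬝ᵥ (K *ᵥ v) ≤ lam * (v ⬝ᵥ v)) (p : ℕ) :
    ∀ (A : Matrix (Fin n) (Fin n) ℝ) (_ : Aᵀ = A),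
    ∫⁻ ω, ENNReal.ofReal (exp (A + ∑ k, θ • vecMulVec (ξ (ω k)) (ξ (ω k)))).trace
        ∂(Measure.pi fun _ : Fin p => ρ) ≤
      ENNReal.ofReal (1 + (Real.exp (θ * R) - 1) / R * lam) ^ p *
        ENNReal.ofReal (exp A).trace := by
  induction p with
  | zero => intro A hA; simp
  | succ p ih =>
    intro A hA
    set c := ENNReal.ofReal (1 + (Real.exp (θ * R) - 1) / R * lam)
    have hmp := measurePreserving_piFinSuccAbove (fun _ : Fin (p+1) => ρ) 0
    let F : Ω × (Fin p → Ω) → ENNReal := fun z =>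
      ENNReal.ofReal (exp ((A + θ • vecMulVec (ξ z.1) (ξ z.1)) +
        ∑ k, θ • vecMulVec (ξ (z.2 k)) (ξ (z.2 k)))).trace
    have hF : Measurable F := by
      refine ENNReal.measurable_ofReal.comp (rf_meas_trace_exp _ fun i j => ?_)
      simp only [Matrix.add_apply, Matrix.sum_apply, Matrix.smul_apply, vecMulVec_apply,
        smul_eq_mul]
      have h1 : ∀ i, Measurable fun z : Ω × (Fin p → Ω) => ξ z.1 i :=
        fun i => (hm i).comp measurable_fst
      have h2 : ∀ i k, Measurable fun z : Ω × (Fin p → Ω) => ξ (z.2 k) i :=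
        fun i k => (hm i).comp ((measurable_pi_apply k).comp measurable_snd)
      exact (measurable_const.add (((h1 i).mul (h1 j)).const_mul θ)).add
        (Finset.measurable_sum _ fun k _ => ((h2 i k).mul (h2 j k)).const_mul θ)
    have e1 := hmp.lintegral_comp hF
    calc _ = ∫⁻ z, F z ∂(ρ.prod (Measure.pi fun _ : Fin p => ρ)) := by
          refine Eq.trans ?_ e1
          refine lintegral_congr fun ω => ?_
          simp only [F]
          rw [Fin.sum_univ_succ, ← add_assoc]
          rfl
      _ = ∫⁻ a, ∫⁻ b, F (a, b) ∂(Measure.pi fun _ : Fin p => ρ) ∂ρ :=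
          lintegral_prod _ hF.aemeasurable
      _ ≤ ∫⁻ a, c ^ p * ENNReal.ofReal (exp (A + θ • vecMulVec (ξ a) (ξ a))).trace ∂ρ := by
          refine lintegral_mono fun a => ih _ ?_
          rw [transpose_add, transpose_smul, transpose_vecMulVec, hA]
      _ = c ^ p * ∫⁻ a, ENNReal.ofReal (exp (A + θ • vecMulVec (ξ a) (ξ a))).trace ∂ρ := by
          rw [lintegral_const_mul' _ _ (by simp [c])]
      _ ≤ c ^ p * (c * ENNReal.ofReal (exp A).trace) := by
          gcongr
          exact rf_lintegral_step ρ ξ hinteg K hK lam θ R hlam hθ hR0 hR hq A hA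
      _ = _ := by rw [pow_succ, mul_assoc]

/-- Scalar lower tail. -/
lemma rf_lower (ρ : Measure Ω) [IsProbabilityMeasure ρ] (Y : Ω → ℝ) (hm : Measurable Y)
    (R lam α : ℝ) (hR0 : 0 < R) (hY0 : ∀ ω, 0 ≤ Y ω) (hYR : ∀ ω, Y ω ≤ R)
    (hlam : ∫ ω, Y ω ∂ρ = lam) (hα0 : 0 < α) (p : ℕ) :
    (Measure.pi fun _ : Fin p => ρ) {ω | ∑ k, Y (ω k) < p * ((1 - α) * lam)} ≤
      ENNReal.ofReal (Real.exp (-(p * lam / R * (α ^ 2 / 2)))) := by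
  have hYi : Integrable Y ρ := Integrable.of_bound hm.aestronglyMeasurable R
    (Filter.Eventually.of_forall fun ω => by rw [Real.norm_eq_abs, abs_of_nonneg (hY0 ω)]; exact hYR ω)
  have hlam0 : 0 ≤ lam := hlam ▸ integral_nonneg hY0
  set θ := α / R
  have hθ : 0 < θ := by positivity
  set f : Ω → ℝ := fun ω => Real.exp (-θ * Y ω)
  have hfm : Measurable f := Real.measurable_exp.comp (hm.const_mul _)
  have hq : Real.exp (-α) ≤ 1 - α + α ^ 2 / 2 := by
    have h1 := Real.quadratic_le_exp_of_nonneg hα0.le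
    rw [Real.exp_neg]
    refine inv_le_of_inv_le₀ (by nlinarith [sq_nonneg (α - 1)]) ?_
    refine le_trans ?_ h1
    rw [inv_le_iff_one_le_mul₀ (by nlinarith [sq_nonneg (α - 1)])]
    nlinarith [sq_nonneg (α ^ 2)]
  have hfle : ∀ ω, f ω ≤ 1 - (α - α ^ 2 / 2) / R * Y ω := fun ω => by
    have h := convexOn_exp.2 (Set.mem_univ (-α)) (Set.mem_univ 0)
      (show 0 ≤ Y ω / R from div_nonneg (hY0 ω) hR0.le)
      (show 0 ≤ 1 - Y ω / R by rw [sub_nonneg, div_le_one hR0]; exact hYR ω) (by ring)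
    have e : (Y ω / R) • (-α) + (1 - Y ω / R) • (0:ℝ) = -θ * Y ω := by
      simp [θ]; field_simp
    rw [e, Real.exp_zero, smul_eq_mul, smul_eq_mul] at h
    have h2 := mul_le_mul_of_nonneg_left hq (div_nonneg (hY0 ω) hR0.le)
    have e2 : (α - α ^ 2 / 2) / R * Y ω = Y ω / R * (α - α ^ 2 / 2) := by ring
    rw [e2]
    calc f ω ≤ _ := h
      _ ≤ _ := by nlinarith
  have hf1 : ∀ ω, f ω ≤ 1 := fun ω => Real.exp_le_one_iff.2 (by nlinarith [mul_nonneg hθ.le (hY0 ω)])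
  have hfi : Integrable f ρ := Integrable.of_bound hfm.aestronglyMeasurable 1
    (Filter.Eventually.of_forall fun ω => by
      rw [Real.norm_eq_abs, abs_of_pos (Real.exp_pos _)]; exact hf1 ω)
  have hEf : ∫ ω, f ω ∂ρ ≤ Real.exp (-((α - α ^ 2 / 2) / R * lam)) := by
    have h1 := integral_mono hfi ((integrable_const 1).sub (hYi.const_mul _)) hfle
    have h2 : ∫ ω, (1 - (α - α ^ 2 / 2) / R * Y ω) ∂ρ = 1 - (α - α ^ 2 / 2) / R * lam := by
      rw [integral_sub (integrable_const _) (hYi.const_mul _), integral_const_mul, hlam]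
      simp
    have h3 := Real.add_one_le_exp (-((α - α ^ 2 / 2) / R * lam))
    refine h1.trans ?_
    change ∫ ω, (1 - (α - α ^ 2 / 2) / R * Y ω) ∂ρ ≤ _
    linarith
  have hEf0 : 0 ≤ ∫ ω, f ω ∂ρ := integral_nonneg fun ω => (Real.exp_pos _).le
  set μ := Measure.pi fun _ : Fin p => ρ
  have hgm : Measurable fun ω : Fin p → Ω => ∏ k, f (ω k) :=
    Finset.measurable_prod _ fun k _ => hfm.comp (measurable_pi_apply k)
  have hg0 : ∀ ω : Fin p → Ω, 0 ≤ ∏ k, f (ω k) :=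
    fun ω => Finset.prod_nonneg fun k _ => (Real.exp_pos _).le
  have hgi : Integrable (fun ω : Fin p → Ω => ∏ k, f (ω k)) μ :=
    Integrable.of_bound hgm.aestronglyMeasurable 1
    (Filter.Eventually.of_forall fun ω => by
      rw [Real.norm_eq_abs, abs_of_nonneg (hg0 ω)]
      exact Finset.prod_le_one (fun k _ => (Real.exp_pos _).le) fun k _ => hf1 _)
  set T := Real.exp (-θ * (p * ((1 - α) * lam)))
  have hT : 0 < T := Real.exp_pos _
  have hmk := mul_meas_ge_le_integral_of_nonneg (μ := μ) (Filter.Eventually.of_forall hg0) hgi T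
  have hinteg : ∫ ω, ∏ k, f (ω k) ∂μ = (∫ ω, f ω ∂ρ) ^ p := by
    have := integral_fintype_prod_eq_pow (ι := Fin p) (𝕜 := ℝ) f (μ := ρ)
    simpa using this
  have hsub : {ω : Fin p → Ω | ∑ k, Y (ω k) < p * ((1 - α) * lam)} ⊆ {ω | T ≤ ∏ k, f (ω k)} := by
    intro ω hω
    simp only [Set.mem_ofPred_eq] at hω ⊢
    simp only [f, T, ← Real.exp_sum, ← Finset.mul_sum]
    exact Real.exp_le_exp.2 (by nlinarith)
  refine (measure_mono hsub).trans ?_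
  rw [← ofReal_measureReal]
  refine ENNReal.ofReal_le_ofReal ?_
  have h4 : (∫ ω, f ω ∂ρ) ^ p ≤ Real.exp (-((α - α ^ 2 / 2) / R * lam)) ^ p :=
    pow_le_pow_left₀ hEf0 hEf p
  rw [hinteg] at hmk
  refine le_of_mul_le_mul_left ((hmk.trans h4).trans_eq ?_) hT
  rw [← Real.exp_nat_mul, ← Real.exp_add]
  congr 1
  simp only [θ]
  field_simp
  ring
end PR

section UP
open NormedSpace
variable {Ω : Type*} [MeasurableSpace Ω] {n : ℕ}

/-- Matrix upper tail. -/
lemma rf_upper (ρ : Measure Ω) [IsProbabilityMeasure ρ] (ξ : Ω → Fin n → ℝ)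
    (hm : ∀ i, Measurable fun ω => ξ ω i)
    (hinteg : ∀ i j, Integrable (fun ω => ξ ω i * ξ ω j) ρ)
    (K : Matrix (Fin n) (Fin n) ℝ) (hK : ∀ i j, K i j = ∫ ω, ξ ω i * ξ ω j ∂ρ)
    (lam R α : ℝ) (hlam : 0 ≤ lam) (hα0 : 0 < α) (hR0 : 0 < R) (hR : ∀ ω, ξ ω ⬝ᵥ ξ ω ≤ R)
    (hq : ∀ v : Fin n → ℝ, v ⬝ᵥ (K *ᵥ v) ≤ lam * (v ⬝ᵥ v)) (p : ℕ) :
    (Measure.pi fun _ : Fin p => ρ) {ω | ∃ μ : ℝ, ∃ v : Fin n → ℝ, p * ((1 + α) * lam) < μ ∧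
      v ⬝ᵥ v = 1 ∧ (∑ k, vecMulVec (ξ (ω k)) (ξ (ω k))) *ᵥ v = μ • v} ≤
      ENNReal.ofReal (n * Real.exp (-(p * lam / R * (α ^ 2 / (2 + α))))) := by
  set θ := Real.log (1 + α) / R
  have hlog : 0 < Real.log (1 + α) := Real.log_pos (by linarith)
  have hθ : 0 < θ := by positivity
  have h := rf_lintegral_pi ρ ξ hm hinteg K hK lam θ R hlam hθ.le hR0 hR hq p 0 (by simp)
  set μ := Measure.pi fun _ : Fin p => ρ
  set F : (Fin p → Ω) → ENNReal := fun ω =>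
    ENNReal.ofReal (exp (0 + ∑ k, θ • vecMulVec (ξ (ω k)) (ξ (ω k)))).trace
  have hF : Measurable F := by
    refine ENNReal.measurable_ofReal.comp (rf_meas_trace_exp _ fun i j => ?_)
    simp only [Matrix.add_apply, Matrix.sum_apply, Matrix.smul_apply, vecMulVec_apply,
      smul_eq_mul]
    have h2 : ∀ i k, Measurable fun z : Fin p → Ω => ξ (z k) i :=
      fun i k => (hm i).comp (measurable_pi_apply k)
    exact measurable_const.add
      (Finset.measurable_sum _ fun k _ => ((h2 i k).mul (h2 j k)).const_mul θ)
  set T := Real.exp (θ * (p * ((1 + α) * lam))) with hTdef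
  have hT : 0 < T := Real.exp_pos _
  have hmk := mul_meas_ge_le_lintegral (μ := μ) hF (ENNReal.ofReal T)
  have hsub : {ω : Fin p → Ω | ∃ μ : ℝ, ∃ v : Fin n → ℝ, p * ((1 + α) * lam) < μ ∧
      v ⬝ᵥ v = 1 ∧ (∑ k, vecMulVec (ξ (ω k)) (ξ (ω k))) *ᵥ v = μ • v} ⊆
      {ω | ENNReal.ofReal T ≤ F ω} := by
    rintro ω ⟨ν, v, hν, hv, hv2⟩
    refine ENNReal.ofReal_le_ofReal ?_
    rw [zero_add, ← Finset.smul_sum]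
    refine le_trans ?_ (rf_exp_le_trace _ ?_ (θ * ν) v hv ?_)
    · exact Real.exp_le_exp.2 (mul_le_mul_of_nonneg_left hν.le hθ.le)
    · rw [transpose_smul, transpose_sum]
      simp only [transpose_vecMulVec]
    · rw [smul_mulVec, hv2, smul_smul]
  refine (measure_mono hsub).trans ?_
  have hTne : ENNReal.ofReal T ≠ 0 := by simpa using hT
  have e0 : (Real.exp (θ * R) - 1) / R = α / R := by
    have : θ * R = Real.log (1 + α) := by simp only [θ]; field_simp
    rw [this, Real.exp_log (by linarith)]; ring
  have hc : (1 + (Real.exp (θ * R) - 1) / R * lam) ≤ Real.exp (α / R * lam) := by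
    rw [e0]
    linarith [Real.add_one_le_exp (α / R * lam)]
  have h5 : ENNReal.ofReal T * μ {ω | ENNReal.ofReal T ≤ F ω} ≤
      ENNReal.ofReal (Real.exp (α / R * lam) ^ p * n) := by
    refine (hmk.trans h).trans ?_
    rw [NormedSpace.exp_zero, trace_one, Fintype.card_fin, ENNReal.ofReal_mul (by positivity),
      ENNReal.ofReal_pow (by positivity)]
    gcongr
  have h6 : ENNReal.ofReal (Real.exp (α / R * lam) ^ p * n) ≤ ENNReal.ofReal T *
      ENNReal.ofReal (n * Real.exp (-(p * lam / R * (α ^ 2 / (2 + α))))) := by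
    rw [← ENNReal.ofReal_mul hT.le]
    refine ENNReal.ofReal_le_ofReal ?_
    rw [mul_comm _ (n:ℝ), mul_left_comm]
    gcongr
    rw [← Real.exp_nat_mul, hTdef, ← Real.exp_add]
    refine Real.exp_le_exp.2 ?_
    have hl := Real.le_log_one_add_of_nonneg hα0.le
    have hs : 0 ≤ p * lam / R := by positivity
    have h7 : α + α ^ 2 / (2 + α) ≤ (1 + α) * Real.log (1 + α) := by
      have := mul_le_mul_of_nonneg_left hl (show 0 ≤ 1 + α by linarith)
      refine le_trans (le_of_eq ?_) this
      field_simp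
      ring
    have h8 := mul_le_mul_of_nonneg_left h7 hs
    have e1 : (p:ℝ) * (α / R * lam) = p * lam / R * α := by ring
    have e2 : θ * (p * ((1 + α) * lam)) = p * lam / R * ((1 + α) * Real.log (1 + α)) := by
      simp only [θ]; ring
    rw [e1, e2]
    linarith
  exact (ENNReal.mul_le_mul_iff_right hTne ENNReal.ofReal_ne_top).1 (h5.trans h6)
end UP

/-- Concentration of the random features Gram matrix: if the features are
uniformly bounded by `B` and `p ≥ (2/α)(1/α + 2/3)(n B²/‖K‖) log(2n/δ)`, then
with probability at least `1 - δ` over the i.i.d. draws `ω_1,…,ω_p ∼ ρ`,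
`(1-α)‖K‖ ≤ ‖Z Zᵀ‖ ≤ (1+α)‖K‖`. -/
theorem random_features_gram_concentration
    {𝒳 : Type*} {Ω : Type*} [MeasurableSpace Ω]
    (ρ : Measure Ω) [IsProbabilityMeasure ρ]
    (φ : 𝒳 → Ω → ℝ) (hφ : ∀ x, Measurable (φ x))
    (B : ℝ) (hB : 0 < B) (hBbd : ∀ x ω, |φ x ω| ≤ B)
    {n p : ℕ} (x : Fin n → 𝒳)
    (K : Matrix (Fin n) (Fin n) ℝ)
    (hK : ∀ i j, K i j = ∫ ω, φ (x i) ω * φ (x j) ω ∂ρ)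
    (Z : (Fin p → Ω) → Matrix (Fin n) (Fin p) ℝ)
    (hZ : ∀ ω i k, Z ω i k = φ (x i) (ω k) / Real.sqrt p)
    (α δ : ℝ) (hα0 : 0 < α) (hα1 : α < 1) (hδ0 : 0 < δ) (hδ1 : δ < 1)
    (hp : (2 / α) * (1 / α + 2 / 3) * ((n : ℝ) * B ^ 2 / lamMax K) *
        Real.log (2 * n / δ) ≤ (p : ℝ)) :
    ENNReal.ofReal (1 - δ) ≤
      (Measure.pi fun _ : Fin p => ρ)
        {ω | (1 - α) * lamMax K ≤ lamMax (Z ω * (Z ω)ᵀ) ∧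
             lamMax (Z ω * (Z ω)ᵀ) ≤ (1 + α) * lamMax K} := by
  have hone : ENNReal.ofReal (1 - δ) ≤ 1 := by
    rw [← ENNReal.ofReal_one]; exact ENNReal.ofReal_le_ofReal (by linarith)
  rcases Nat.eq_zero_or_pos n with hn | hn
  · subst hn
    have h0 : ∀ M : Matrix (Fin 0) (Fin 0) ℝ, lamMax M = lamMax K := fun M => by
      rw [Subsingleton.elim M K]
    have h1 : lamMax K = 0 := by
      have : {μ : ℝ | Module.End.HasEigenvalue (Matrix.toLin' K) μ} = ∅ := by
        ext μ
        simp only [Set.mem_ofPred_eq, Set.mem_empty_iff_false, iff_false, rf_eig_iff]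
        rintro ⟨v, hv, -⟩
        exact hv (Subsingleton.elim _ _)
      rw [lamMax, this, Real.sSup_empty]
    simp only [h0, h1, mul_zero, le_refl, and_self]
    simpa using hone
  have : Nonempty (Fin n) := ⟨⟨0, hn⟩⟩
  have hnR : (1:ℝ) ≤ n := by exact_mod_cast hn
  set ξ : Ω → Fin n → ℝ := fun ω i => φ (x i) ω with hξ
  set R : ℝ := n * B ^ 2 with hRdef
  have hR0 : 0 < R := by positivity
  have hm : ∀ i, Measurable fun ω => ξ ω i := fun i => hφ (x i)
  have hinteg : ∀ i j, Integrable (fun ω => ξ ω i * ξ ω j) ρ := fun i j =>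
    Integrable.of_bound ((hm i).mul (hm j)).aestronglyMeasurable (B * B)
      (Filter.Eventually.of_forall fun ω => by
        rw [norm_mul]
        exact mul_le_mul (hBbd _ _) (hBbd _ _) (norm_nonneg _) hB.le)
  have hR : ∀ ω, ξ ω ⬝ᵥ ξ ω ≤ R := fun ω => by
    have : ∀ i ∈ Finset.univ, ξ ω i * ξ ω i ≤ B ^ 2 := fun i _ => by
      rw [← pow_two, ← sq_abs]
      exact pow_le_pow_left₀ (abs_nonneg _) (hBbd _ _) 2
    have := Finset.sum_le_sum this
    simpa [dotProduct, hRdef] using this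
  have hKs : Kᵀ = K := by
    ext i j; rw [transpose_apply, hK, hK]; simp only [mul_comm]
  obtain ⟨⟨u, hu, hKu⟩, hq⟩ := rf_lamMax_spec K hKs
  set lam := lamMax K with hlamdef
  -- the scalar features
  have hYe : ∀ ω, (u ⬝ᵥ ξ ω) ^ 2 = ξ ω ⬝ᵥ (vecMulVec u u *ᵥ ξ ω) := fun ω => by
    rw [vecMulVec_mulVec, op_smul_eq_smul, dotProduct_smul, smul_eq_mul, dotProduct_comm (ξ ω) u,
      pow_two]
  obtain ⟨-, hYint⟩ := rf_integral_quad ρ ξ hinteg K hK (vecMulVec u u)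
  have hYlam : ∫ ω, (u ⬝ᵥ ξ ω) ^ 2 ∂ρ = lam := by
    simp only [hYe]
    rw [hYint]
    have h1 : u ⬝ᵥ (K *ᵥ u) = lam := by rw [hKu, dotProduct_smul, hu, smul_eq_mul, mul_one]
    rw [← h1]
    simp only [dotProduct, mulVec, Finset.mul_sum, vecMulVec_apply]
    exact Finset.sum_congr rfl fun i _ => Finset.sum_congr rfl fun j _ => by ring
  have hlam0 : 0 ≤ lam := hYlam ▸ integral_nonneg fun ω => sq_nonneg _
  have hZZs : ∀ ω, (Z ω * (Z ω)ᵀ)ᵀ = Z ω * (Z ω)ᵀ := fun ω => by simp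
  rcases hlam0.eq_or_lt with hl | hlpos
  · -- degenerate case
    have h1 : ∀ i, ∀ᵐ ω ∂ρ, ξ ω i = 0 := fun i => by
      have h2 := hq (Pi.single i 1)
      rw [← hl, zero_mul] at h2
      have h3 : K i i ≤ 0 := by simpa using h2
      have h4 : ∫ ω, ξ ω i * ξ ω i ∂ρ = 0 :=
        le_antisymm (by rw [hK] at h3; exact h3) (integral_nonneg fun ω => mul_self_nonneg _)
      have h5 := (integral_eq_zero_iff_of_nonneg (fun ω => mul_self_nonneg (ξ ω i)) (hinteg i i)).1 h4
      filter_upwards [h5] with ω hω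
      simpa using hω
    have h2 : ∀ᵐ ω ∂(Measure.pi fun _ : Fin p => ρ), ∀ k i, ξ (ω k) i = 0 := by
      rw [ae_all_iff]; intro k
      rw [ae_all_iff]; intro i
      exact (Measure.tendsto_eval_ae_ae (μ := fun _ : Fin p => ρ) (i := k)).eventually (h1 i)
    have h3 : ∀ᵐ ω ∂(Measure.pi fun _ : Fin p => ρ),
        ω ∈ {ω | (1 - α) * lam ≤ lamMax (Z ω * (Z ω)ᵀ) ∧
             lamMax (Z ω * (Z ω)ᵀ) ≤ (1 + α) * lam} := by
      filter_upwards [h2] with ω hω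
      have hz : Z ω = 0 := by
        ext i k
        have := hω k i
        simp only [hξ] at this
        rw [hZ, this]; simp
      have hl0 : lamMax (Z ω * (Z ω)ᵀ) = 0 := by
        obtain ⟨⟨v, hv, hv2⟩, -⟩ := rf_lamMax_spec _ (hZZs ω)
        have h6 := congrArg (fun w => v ⬝ᵥ w) hv2
        simp only [dotProduct_smul, hv, smul_eq_mul, mul_one] at h6
        rw [← h6, hz]; simp
      simp only [hl0, ← hl, mul_zero, le_refl, and_self]
    exact hone.trans_eq ((measure_congr (Filter.eventuallyEq_univ.2 h3)).trans measure_univ).symm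
  -- main case
  set Lg := Real.log (2 * n / δ) with hLg
  have hLpos : 0 < Lg := Real.log_pos (by rw [lt_div_iff₀ hδ0]; linarith)
  have hppos : 0 < (p : ℝ) := lt_of_lt_of_le (by positivity) hp
  have hexpL : Real.exp (-Lg) = δ / (2 * n) := by
    rw [Real.exp_neg, hLg, Real.exp_log (by positivity), inv_div]
  have hkey : Lg ≤ p * lam / R * (α ^ 2 / (2 + α)) := by
    have h1 : (2 / α) * (1 / α + 2 / 3) * (R / lam) * Lg = (2 + 4 * α / 3) / α ^ 2 * (R / lam) * Lg := by
      field_simp; ring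
    rw [h1] at hp
    have h2 : (2 + α) / α ^ 2 * (R / lam) * Lg ≤ p := by
      refine le_trans ?_ hp
      gcongr
      linarith
    have h3 : 0 ≤ lam / R * (α ^ 2 / (2 + α)) := by positivity
    have h4 := mul_le_mul_of_nonneg_right h2 h3
    refine le_trans (le_of_eq ?_) (h4.trans_eq (by ring))
    field_simp
  have hkey2 : Lg ≤ p * lam / R * (α ^ 2 / 2) := by
    refine hkey.trans ?_
    gcongr
    linarith
  have hgram : ∀ ω, (p:ℝ) • (Z ω * (Z ω)ᵀ) = ∑ k, vecMulVec (ξ (ω k)) (ξ (ω k)) := fun ω => by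
    ext i j
    simp only [Matrix.smul_apply, Matrix.mul_apply, transpose_apply, Matrix.sum_apply,
      vecMulVec_apply, smul_eq_mul, Finset.mul_sum, hZ, hξ]
    refine Finset.sum_congr rfl fun k _ => ?_
    rw [div_mul_div_comm, Real.mul_self_sqrt hppos.le]
    field_simp
  have hup := rf_upper ρ ξ hm hinteg K hK lam R α hlam0 hα0 hR0 hR hq p
  have hYm : Measurable fun ω => (u ⬝ᵥ ξ ω) ^ 2 :=
    (Finset.measurable_sum _ fun i _ => (hm i).const_mul (u i)).pow_const 2
  have hlo := rf_lower ρ (fun ω => (u ⬝ᵥ ξ ω) ^ 2) hYm R lam α hR0 (fun ω => sq_nonneg _)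
    (fun ω => by
      refine le_trans ?_ (hR ω)
      have := Finset.sum_mul_sq_le_sq_mul_sq Finset.univ u (ξ ω)
      have hu' : ∑ i, u i ^ 2 = 1 := by rw [← hu]; simp [dotProduct, pow_two]
      rw [hu', one_mul] at this
      simpa [dotProduct, pow_two] using this) hYlam hα0 p
  set μ := Measure.pi fun _ : Fin p => ρ
  set S1 := {ω : Fin p → Ω | ∃ μ : ℝ, ∃ v : Fin n → ℝ, p * ((1 + α) * lam) < μ ∧
      v ⬝ᵥ v = 1 ∧ (∑ k, vecMulVec (ξ (ω k)) (ξ (ω k))) *ᵥ v = μ • v} with hS1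
  set S2 := {ω : Fin p → Ω | ∑ k, (u ⬝ᵥ ξ (ω k)) ^ 2 < p * ((1 - α) * lam)} with hS2
  set S := {ω | (1 - α) * lam ≤ lamMax (Z ω * (Z ω)ᵀ) ∧
             lamMax (Z ω * (Z ω)ᵀ) ≤ (1 + α) * lam} with hS
  have hcov : Set.univ ⊆ S ∪ (S1 ∪ S2) := by
    intro ω _
    by_contra hcon
    simp only [Set.mem_union, not_or] at hcon
    obtain ⟨hc, hc1, hc2⟩ := hcon
    obtain ⟨⟨v, hv, hv2⟩, hq2⟩ := rf_lamMax_spec _ (hZZs ω)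
    refine hc ⟨?_, ?_⟩
    · have h1 : p * ((1 - α) * lam) ≤ ∑ k, (u ⬝ᵥ ξ (ω k)) ^ 2 := not_lt.1 hc2
      have h2 : ∑ k, (u ⬝ᵥ ξ (ω k)) ^ 2 = p * (u ⬝ᵥ ((Z ω * (Z ω)ᵀ) *ᵥ u)) := by
        rw [← smul_eq_mul, ← dotProduct_smul, ← smul_mulVec, hgram, sum_mulVec, dotProduct_sum]
        refine Finset.sum_congr rfl fun k _ => ?_
        rw [vecMulVec_mulVec, op_smul_eq_smul, dotProduct_smul, smul_eq_mul,
          dotProduct_comm (ξ (ω k)) u, pow_two]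
      have h3 := hq2 u
      rw [hu, mul_one] at h3
      rw [h2] at h1
      exact (le_of_mul_le_mul_left h1 hppos).trans h3
    · by_contra h4
      refine hc1 ⟨p * lamMax (Z ω * (Z ω)ᵀ), v, ?_, hv, ?_⟩
      · exact mul_lt_mul_of_pos_left (not_le.1 h4) hppos
      · rw [← hgram, smul_mulVec, hv2, smul_smul]
  have hb1 : μ S1 ≤ ENNReal.ofReal (δ / 2) := by
    refine hup.trans (ENNReal.ofReal_le_ofReal ?_)
    have h1 : Real.exp (-(p * lam / R * (α ^ 2 / (2 + α)))) ≤ δ / (2 * n) := by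
      rw [← hexpL]; exact Real.exp_le_exp.2 (by linarith)
    refine (mul_le_mul_of_nonneg_left h1 (by positivity)).trans_eq ?_
    field_simp
  have hb2 : μ S2 ≤ ENNReal.ofReal (δ / 2) := by
    refine hlo.trans (ENNReal.ofReal_le_ofReal ?_)
    have h1 : Real.exp (-(p * lam / R * (α ^ 2 / 2))) ≤ δ / (2 * n) := by
      rw [← hexpL]; exact Real.exp_le_exp.2 (by linarith)
    refine h1.trans ?_
    gcongr
    linarith
  have hfin : (1 : ENNReal) ≤ μ S + ENNReal.ofReal δ := by
    calc (1 : ENNReal) = μ Set.univ := by simp [μ]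
      _ ≤ μ (S ∪ (S1 ∪ S2)) := measure_mono hcov
      _ ≤ μ S + (μ S1 + μ S2) :=
        (measure_union_le _ _).trans (by gcongr; exact measure_union_le _ _)
      _ ≤ μ S + (ENNReal.ofReal (δ / 2) + ENNReal.ofReal (δ / 2)) := by gcongr
      _ = μ S + ENNReal.ofReal δ := by
        rw [← ENNReal.ofReal_add (by positivity) (by positivity), add_halves]
  rw [ENNReal.ofReal_sub _ hδ0.le, ENNReal.ofReal_one]
  exact tsub_le_iff_right.2 hfin
end
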